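/- (Monotonicity in the upper half-space, parabolic.) Let n ≥ 1, s ∈ (0,1), 0 < α ≤ 1, and write ℝⁿ₊ = {x = (x', x_n) ∈ ℝⁿ : x_n > 0}. Let h : ℝ × ℝ → ℝ be continuous and nonincreasing in its second argument. Let u(x,t) with u(·,t) ∈ C²(ℝⁿ₊) ∩ L̃_{2s} ∩ C(closure of ℝⁿ₊) for each t and u(x,·) ∈ C¹(ℝ) ∩ L⁻_α(ℝ) for each x be a nonnegative bounded function satisfying ∂_t^α u(x,t) + (−Δ)^s u(x,t) − Δu(x,t) = h(t, u(x,t)) for all (x,t) ∈ ℝⁿ₊ × ℝ, u(x,t) > 0 for all (x,t) ∈ ℝⁿ₊ × ℝ, and u(x,t) = 0 for all (x,t) ∈ (ℝⁿ ∖ ℝⁿ₊) × ℝ. Then u is strictly increasing with respect to x_n: for every τ > 0, every t ∈ ℝ, and every x = (x', x_n) ∈ ℝⁿ₊, one has u(x', x_n + τ, t) > u(x', x_n, t). -/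

import Mathlib

open MeasureTheory Filter Set

noncomputable section

/-- `ℝⁿ` as a Euclidean space. -/
abbrev En (n : ℕ) : Type := EuclideanSpace ℝ (Fin n)

/-- `HasFracLap n s Cns u x L` says that the principal value defining the fractional
Laplacian `(-Δ)ˢ u (x) = Cns · P.V. ∫ (u x - u y)/|x-y|^{n+2s} dy` exists and equals `L`. -/
def HasFracLap (n : ℕ) (s Cns : ℝ) (u : En n → ℝ) (x : En n) (L : ℝ) : Prop :=
  Tendsto
    (fun ε : ℝ =>
      Cns * ∫ y in {y : En n | ε ≤ ‖x - y‖}, (u x - u y) / ‖x - y‖ ^ ((n : ℝ) + 2 * s))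
    (nhdsWithin 0 (Set.Ioi 0)) (nhds L)

/-- The classical Laplacian `Δu(x) = ∑ ∂²u/∂xᵢ²`. -/
def lap {n : ℕ} (u : En n → ℝ) (x : En n) : ℝ :=
  ∑ i : Fin n, iteratedFDeriv ℝ 2 u x fun _ => EuclideanSpace.single i (1 : ℝ)

/-- Membership in the tail space `L_{2s}`. -/
def MemL2s (n : ℕ) (s : ℝ) (u : En n → ℝ) : Prop :=
  LocallyIntegrable u volume ∧
    Integrable (fun x : En n => u x / (1 + ‖x‖ ^ ((n : ℝ) + 2 * s))) volume

/-- The Marchaud fractional time derivative of order `α ∈ (0,1)`; for `α = 1` it is the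
classical derivative. -/
def marchaud (α : ℝ) (v : ℝ → ℝ) (t : ℝ) : ℝ :=
  if α = 1 then deriv v t
  else (α / Real.Gamma (1 - α)) * ∫ τ in Set.Iio t, (v t - v τ) / (t - τ) ^ (1 + α)

/-- Membership in the space `𝓛⁻_α(ℝ)`. -/
def MemLminus (α : ℝ) (v : ℝ → ℝ) : Prop :=
  LocallyIntegrable v volume ∧
    ∀ t : ℝ, IntegrableOn (fun τ : ℝ => v τ / (1 + |τ| ^ (1 + α))) (Set.Iio t) volume

/-- Width of a set in the direction of the coordinate `i₀`. -/
def widthLast {n : ℕ} (i₀ : Fin n) (Ω : Set (En n)) : ℝ :=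
  sSup ((fun x : En n => x i₀) '' Ω) - sInf ((fun x : En n => x i₀) '' Ω)

/-- The unit vector in the direction of the coordinate `i₀`. -/
def eDir {n : ℕ} (i₀ : Fin n) : En n := EuclideanSpace.single i₀ (1 : ℝ)

/-- The kernel `‖z‖^{-(n+2s)}` of the fractional Laplacian. -/
def fracKernel (n : ℕ) (s : ℝ) (z : En n) : ℝ := (‖z‖ ^ ((n : ℝ) + 2 * s))⁻¹

lemma fracKernel_nonneg (n : ℕ) (s : ℝ) (z : En n) : 0 ≤ fracKernel n s z := by
  unfold fracKernel; positivity

lemma fracKernel_neg (n : ℕ) (s : ℝ) (z : En n) : fracKernel n s (-z) = fracKernel n s z := by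
  simp [fracKernel]

lemma fracKernel_smul (n : ℕ) (s : ℝ) {R : ℝ} (hR : 0 < R) (z : En n) :
    fracKernel n s (R • z) = (R ^ ((n : ℝ) + 2 * s))⁻¹ * fracKernel n s z := by
  unfold fracKernel
  rw [norm_smul, Real.norm_of_nonneg hR.le, Real.mul_rpow hR.le (norm_nonneg z), mul_inv]

lemma measurable_fracKernel (n : ℕ) (s : ℝ) : Measurable (fracKernel n s) := by
  unfold fracKernel; fun_prop

lemma integrable_min_mul_fracKernel {n : ℕ} (hn : 1 ≤ n) {s : ℝ} (hs : s ∈ Ioo (0 : ℝ) 1) :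
    Integrable (fun z : En n => min (‖z‖ ^ 2) 1 * fracKernel n s z) := by
  have : Nonempty (Fin n) := ⟨⟨0, hn⟩⟩
  have key := (integrable_fun_norm_addHaar (E := En n) volume
    (f := fun r : ℝ => min (r ^ 2) 1 * (r ^ ((n : ℝ) + 2 * s))⁻¹)).2 ?_
  · exact key
  rw [finrank_euclideanSpace_fin, ← Ioc_union_Ioi_eq_Ioi (zero_le_one' ℝ)]
  have hcast : ((n - 1 : ℕ) : ℝ) = (n : ℝ) - 1 := by push_cast [Nat.cast_sub hn]; ring
  have hexp : ∀ r : ℝ, 0 < r → r ^ (n - 1) * (r ^ ((n : ℝ) + 2 * s))⁻¹ = r ^ (-1 - 2 * s) := by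
    intro r hr
    rw [← Real.rpow_natCast, hcast, ← Real.rpow_neg hr.le, ← Real.rpow_add hr]
    congr 1; ring
  refine IntegrableOn.union ?_ ?_
  · have h1 : IntegrableOn (fun r : ℝ => r ^ (1 - 2 * s)) (Ioc 0 1) := by
      rw [← intervalIntegrable_iff_integrableOn_Ioc_of_le zero_le_one]
      exact intervalIntegral.intervalIntegrable_rpow' (by linarith [hs.2])
    refine h1.congr_fun (fun r hr => ?_) measurableSet_Ioc
    have h2 : r ^ 2 ≤ 1 := by nlinarith [hr.1, hr.2]
    simp only [smul_eq_mul]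
    rw [min_eq_left h2, mul_left_comm, hexp r hr.1, ← Real.rpow_natCast, ← Real.rpow_add hr.1]
    congr 1; push_cast; ring
  · have h1 : IntegrableOn (fun r : ℝ => r ^ (-1 - 2 * s)) (Ioi 1) :=
      integrableOn_Ioi_rpow_of_lt (by linarith [hs.1]) one_pos
    refine h1.congr_fun (fun r hr => ?_) measurableSet_Ioi
    have hr' : (1 : ℝ) < r := hr
    have h2 : 1 ≤ r ^ 2 := by nlinarith
    simp only [smul_eq_mul]
    rw [min_eq_right h2, one_mul, hexp r (by linarith)]

lemma integrableOn_fracKernel {n : ℕ} (hn : 1 ≤ n) {s : ℝ} (hs : s ∈ Ioo (0 : ℝ) 1)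
    {r : ℝ} (hr : 0 < r) : IntegrableOn (fracKernel n s) {z : En n | r ≤ ‖z‖} := by
  have hm : 0 < min (r ^ 2) 1 := by positivity
  refine Integrable.mono' (((integrable_min_mul_fracKernel hn hs).const_mul
    (min (r ^ 2) 1)⁻¹).integrableOn) (measurable_fracKernel n s).aestronglyMeasurable ?_
  refine (ae_restrict_iff' (measurableSet_le measurable_const measurable_norm)).2
    (Eventually.of_forall fun z hz => ?_)
  have hz' : r ≤ ‖z‖ := hz
  rw [Real.norm_of_nonneg (fracKernel_nonneg n s z), ← mul_assoc]
  refine le_mul_of_one_le_left (fracKernel_nonneg n s z) ?_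
  rw [← div_eq_inv_mul, one_le_div hm]
  gcongr

/-- The mass of `min(‖z‖², 1)` against the fractional kernel. -/
def fracMass (n : ℕ) (s : ℝ) : ℝ := ∫ z : En n, min (‖z‖ ^ 2) 1 * fracKernel n s z

lemma fracMass_nonneg (n : ℕ) (s : ℝ) : 0 ≤ fracMass n s :=
  integral_nonneg fun z => mul_nonneg (by positivity) (fracKernel_nonneg n s z)

lemma min_sq_div_smul_mul_fracKernel (n : ℕ) (s : ℝ) {R : ℝ} (hR : 0 < R) (z : En n) :
    min (‖R • z‖ ^ 2 / R ^ 2) 1 * fracKernel n s (R • z) =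
      (R ^ ((n : ℝ) + 2 * s))⁻¹ * (min (‖z‖ ^ 2) 1 * fracKernel n s z) := by
  rw [fracKernel_smul n s hR, norm_smul, Real.norm_of_nonneg hR.le, mul_pow,
    mul_div_cancel_left₀ _ (by positivity)]
  ring

lemma integrable_min_div_mul_fracKernel {n : ℕ} (hn : 1 ≤ n) {s : ℝ} (hs : s ∈ Ioo (0 : ℝ) 1)
    {R : ℝ} (hR : 0 < R) :
    Integrable (fun z : En n => min (‖z‖ ^ 2 / R ^ 2) 1 * fracKernel n s z) := by
  rw [← integrable_comp_smul_iff volume _ hR.ne']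
  simp_rw [min_sq_div_smul_mul_fracKernel n s hR]
  exact (integrable_min_mul_fracKernel hn hs).const_mul _

lemma integral_min_div_mul_fracKernel (n : ℕ) (s : ℝ) {R : ℝ} (hR : 0 < R) :
    ∫ z : En n, min (‖z‖ ^ 2 / R ^ 2) 1 * fracKernel n s z =
      (R ^ (2 * s))⁻¹ * fracMass n s := by
  have h1 := Measure.integral_comp_smul (volume : Measure (En n))
    (fun z : En n => min (‖z‖ ^ 2 / R ^ 2) 1 * fracKernel n s z) R
  simp_rw [min_sq_div_smul_mul_fracKernel n s hR] at h1
  rw [integral_const_mul, finrank_euclideanSpace_fin, smul_eq_mul,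
    abs_of_nonneg (by positivity), Real.rpow_add hR, Real.rpow_natCast, mul_inv, mul_assoc] at h1
  exact (mul_left_cancel₀ (by positivity) h1).symm

lemma min_sq_div_second_difference {n : ℕ} {R : ℝ} (hR : 0 < R) (x z : En n) :
    min (‖x + z‖ ^ 2 / R ^ 2) 1 + min (‖x - z‖ ^ 2 / R ^ 2) 1 - 2 * min (‖x‖ ^ 2 / R ^ 2) 1
      ≤ 2 * min (‖z‖ ^ 2 / R ^ 2) 1 := by
  have h1 := min_le_left (‖x + z‖ ^ 2 / R ^ 2) 1
  have h2 := min_le_right (‖x + z‖ ^ 2 / R ^ 2) 1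
  have h3 := min_le_left (‖x - z‖ ^ 2 / R ^ 2) 1
  have h4 := min_le_right (‖x - z‖ ^ 2 / R ^ 2) 1
  have hp := parallelogram_law_with_norm ℝ x z
  have hp' : ‖x + z‖ ^ 2 / R ^ 2 + ‖x - z‖ ^ 2 / R ^ 2 =
      2 * (‖x‖ ^ 2 / R ^ 2) + 2 * (‖z‖ ^ 2 / R ^ 2) := by
    have hR2 : R ^ 2 ≠ 0 := by positivity
    field_simp
    linarith
  have h5 : 0 ≤ ‖z‖ ^ 2 / R ^ 2 := by positivity
  have h6 : 0 ≤ ‖x‖ ^ 2 / R ^ 2 := by positivity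
  rcases min_cases (‖x‖ ^ 2 / R ^ 2) 1 with ⟨h, h'⟩ | ⟨h, h'⟩ <;>
  rcases min_cases (‖z‖ ^ 2 / R ^ 2) 1 with ⟨g, g'⟩ | ⟨g, g'⟩ <;> rw [h, g] <;> linarith

/-- A truncated version of the Marchaud derivative of order `α`; for `α = 1` a backward
difference quotient. -/
def timeQuot (α ε : ℝ) (v : ℝ → ℝ) (t : ℝ) : ℝ :=
  if α = 1 then (v t - v (t - ε)) / ε
  else (α / Real.Gamma (1 - α)) * ∫ ρ in Ioi ε, (v t - v (t - ρ)) / ρ ^ (1 + α)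

lemma integrableOn_min_div_rpow {α : ℝ} (hα : 0 < α) (hα1 : α < 1) :
    IntegrableOn (fun ρ : ℝ => min ρ 1 / ρ ^ (1 + α)) (Ioi 0) := by
  rw [← Ioc_union_Ioi_eq_Ioi (zero_le_one' ℝ)]
  refine IntegrableOn.union ?_ ?_
  · have h1 : IntegrableOn (fun r : ℝ => r ^ (-α)) (Ioc 0 1) := by
      rw [← intervalIntegrable_iff_integrableOn_Ioc_of_le zero_le_one]
      exact intervalIntegral.intervalIntegrable_rpow' (by linarith)
    refine h1.congr_fun (fun r hr => ?_) measurableSet_Ioc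
    simp only
    rw [min_eq_left hr.2, Real.rpow_add hr.1, Real.rpow_one, Real.rpow_neg hr.1.le]
    have := hr.1.ne'
    field_simp
  · have h1 : IntegrableOn (fun r : ℝ => r ^ (-(1 + α))) (Ioi 1) :=
      integrableOn_Ioi_rpow_of_lt (by linarith) one_pos
    refine h1.congr_fun (fun r hr => ?_) measurableSet_Ioi
    have hr' : (1 : ℝ) < r := hr
    simp only
    rw [min_eq_right hr'.le, Real.rpow_neg (by linarith), one_div]

lemma min_div_div_rpow_comp_mul {α T : ℝ} (hT : 0 < T) {ρ : ℝ} (hρ : 0 < ρ) :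
    min (T * ρ / T) 1 / (T * ρ) ^ (1 + α) = (T ^ (1 + α))⁻¹ * (min ρ 1 / ρ ^ (1 + α)) := by
  rw [mul_div_cancel_left₀ _ hT.ne', Real.mul_rpow hT.le hρ.le, div_mul_eq_div_div_swap]
  ring

lemma integrableOn_min_div_div_rpow {α : ℝ} (hα : 0 < α) (hα1 : α < 1) {T : ℝ} (hT : 0 < T) :
    IntegrableOn (fun ρ : ℝ => min (ρ / T) 1 / ρ ^ (1 + α)) (Ioi 0) := by
  have h := integrableOn_Ioi_comp_mul_left_iff
    (fun ρ : ℝ => min (ρ / T) 1 / ρ ^ (1 + α)) 0 hT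
  rw [mul_zero] at h
  refine h.1 ?_
  exact IntegrableOn.congr_fun ((integrableOn_min_div_rpow hα hα1).const_mul ((T ^ (1 + α))⁻¹))
    (fun ρ hρ => (min_div_div_rpow_comp_mul hT hρ).symm) measurableSet_Ioi

lemma integral_min_div_div_rpow (α : ℝ) {T : ℝ} (hT : 0 < T) :
    ∫ ρ in Ioi (0 : ℝ), min (ρ / T) 1 / ρ ^ (1 + α) =
      (T ^ α)⁻¹ * ∫ ρ in Ioi (0 : ℝ), min ρ 1 / ρ ^ (1 + α) := by
  have h := integral_comp_mul_left_Ioi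
    (fun ρ : ℝ => min (ρ / T) 1 / ρ ^ (1 + α)) 0 hT
  rw [mul_zero] at h
  rw [setIntegral_congr_fun measurableSet_Ioi
    (fun ρ (hρ : 0 < ρ) => min_div_div_rpow_comp_mul hT hρ), integral_const_mul,
    smul_eq_mul, Real.rpow_add hT, Real.rpow_one, mul_inv, mul_assoc] at h
  exact (mul_left_cancel₀ (by positivity) h).symm

/-- The constant governing the time cost of a cut-off of length one. -/
def timeConst (α : ℝ) : ℝ :=
  if α = 1 then 1 else
    (α / Real.Gamma (1 - α)) * ∫ ρ in Ioi (0 : ℝ), min ρ 1 / ρ ^ (1 + α)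

lemma marchaudConst_nonneg {α : ℝ} (hα : 0 < α) (hα1 : α < 1) :
    0 ≤ α / Real.Gamma (1 - α) :=
  div_nonneg hα.le (Real.Gamma_pos_of_pos (by linarith)).le

lemma timeConst_nonneg {α : ℝ} (hα : 0 < α) (hα1 : α ≤ 1) : 0 ≤ timeConst α := by
  unfold timeConst
  split_ifs with h
  · exact zero_le_one
  · refine mul_nonneg (marchaudConst_nonneg hα (lt_of_le_of_ne hα1 h)) ?_
    refine setIntegral_nonneg measurableSet_Ioi fun ρ hρ => ?_
    have : (0 : ℝ) < ρ := hρ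
    positivity

lemma integrableOn_timeQuot {α : ℝ} (hα : 0 < α) {ε : ℝ} (hε : 0 < ε) {v : ℝ → ℝ}
    (hv : Continuous v) {M : ℝ} (hM : ∀ t, |v t| ≤ M) (t : ℝ) :
    IntegrableOn (fun ρ : ℝ => (v t - v (t - ρ)) / ρ ^ (1 + α)) (Ioi ε) := by
  have h1 : IntegrableOn (fun r : ℝ => (2 * M) * r ^ (-(1 + α))) (Ioi ε) :=
    (integrableOn_Ioi_rpow_of_lt (by linarith) hε).const_mul _
  have hvm := hv.measurable
  refine Integrable.mono' h1 (Measurable.aestronglyMeasurable (by fun_prop)) ?_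
  refine (ae_restrict_iff' measurableSet_Ioi).2 (Eventually.of_forall fun ρ hρ => ?_)
  have hρ' : 0 < ρ := hε.trans hρ
  rw [Real.norm_eq_abs, abs_div, abs_of_pos (Real.rpow_pos_of_pos hρ' _), Real.rpow_neg hρ'.le,
    div_eq_mul_inv]
  gcongr
  calc |v t - v (t - ρ)| ≤ |v t| + |v (t - ρ)| := abs_sub _ _
    _ ≤ 2 * M := by linarith [hM t, hM (t - ρ)]

lemma timeQuot_ge {α : ℝ} (hα : 0 < α) (hα1 : α ≤ 1) {ε : ℝ} (hε : 0 < ε) {v : ℝ → ℝ}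
    (hv : Continuous v) {M : ℝ} (hM : ∀ t, |v t| ≤ M) {A T : ℝ} (hA : 0 ≤ A) (hT : 0 < T) {t : ℝ}
    (hle : ∀ ρ, 0 < ρ → -(A * min (ρ / T) 1) ≤ v t - v (t - ρ)) :
    -(A * timeConst α * (T ^ α)⁻¹) ≤ timeQuot α ε v t := by
  unfold timeConst timeQuot
  split_ifs with h
  · rw [h, Real.rpow_one, le_div_iff₀ hε]
    have h1 := hle ε hε
    have h2 : A * min (ε / T) 1 ≤ A * (ε / T) := by gcongr; exact min_le_left _ _
    calc -(A * 1 * T⁻¹) * ε = -(A * (ε / T)) := by ring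
      _ ≤ _ := by linarith
  · have hα1' := lt_of_le_of_ne hα1 h
    have hI := integrableOn_min_div_div_rpow hα hα1' hT
    have h1 : ∫ ρ in Ioi ε, -A * (min (ρ / T) 1 / ρ ^ (1 + α)) ≤
        ∫ ρ in Ioi ε, (v t - v (t - ρ)) / ρ ^ (1 + α) := by
      refine setIntegral_mono_on ((hI.mono_set (Ioi_subset_Ioi hε.le)).const_mul _)
        (integrableOn_timeQuot hα hε hv hM t) measurableSet_Ioi fun ρ hρ => ?_
      have hρ' : 0 < ρ := hε.trans hρ
      rw [← mul_div_assoc]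
      gcongr
      linarith [hle ρ hρ']
    have h2 : ∫ ρ in Ioi ε, (min (ρ / T) 1 / ρ ^ (1 + α)) ≤
        ∫ ρ in Ioi 0, (min (ρ / T) 1 / ρ ^ (1 + α)) := by
      refine setIntegral_mono_set hI ?_ (Ioi_subset_Ioi hε.le).eventuallyLE
      refine (ae_restrict_iff' measurableSet_Ioi).2 (Eventually.of_forall fun ρ hρ => ?_)
      have : (0 : ℝ) < ρ := hρ
      simp only [Pi.zero_apply]
      positivity
    rw [integral_const_mul] at h1
    rw [integral_min_div_div_rpow α hT] at h2
    have hc := marchaudConst_nonneg hα hα1'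
    calc _ = (α / Real.Gamma (1 - α)) *
          (-A * ((T ^ α)⁻¹ * ∫ ρ in Ioi (0 : ℝ), min ρ 1 / ρ ^ (1 + α))) := by ring
      _ ≤ _ := by
        gcongr
        refine le_trans ?_ h1
        exact mul_le_mul_of_nonpos_left h2 (by linarith)

lemma timeQuot_sub_const (α ε : ℝ) (v : ℝ → ℝ) (c t : ℝ) :
    timeQuot α ε (fun τ => v τ - c) t = timeQuot α ε v t := by
  simp [timeQuot]

lemma timeQuot_const_mul (α ε : ℝ) (v : ℝ → ℝ) (c t : ℝ) :
    timeQuot α ε (fun τ => c * v τ) t = c * timeQuot α ε v t := by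
  unfold timeQuot
  split_ifs
  · ring
  · simp_rw [← mul_sub, mul_div_assoc]
    rw [integral_const_mul]; ring

lemma timeQuot_shift (α ε : ℝ) (v : ℝ → ℝ) (a t : ℝ) :
    timeQuot α ε (fun τ => v (τ + a)) t = timeQuot α ε v (t + a) := by
  simp only [timeQuot, sub_add_eq_add_sub]

lemma timeQuot_sub {α : ℝ} (hα : 0 < α) {ε : ℝ} (hε : 0 < ε) {v w : ℝ → ℝ}
    (hv : Continuous v) (hw : Continuous w) {M N : ℝ} (hM : ∀ t, |v t| ≤ M)
    (hN : ∀ t, |w t| ≤ N) (t : ℝ) :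
    timeQuot α ε (fun τ => v τ - w τ) t = timeQuot α ε v t - timeQuot α ε w t := by
  unfold timeQuot
  split_ifs
  · ring
  · rw [← mul_sub, ← integral_sub (integrableOn_timeQuot hα hε hv hM t)
      (integrableOn_timeQuot hα hε hw hN t)]
    congr 2 with ρ
    ring

lemma timeQuot_sum {α : ℝ} (hα : 0 < α) {ε : ℝ} (hε : 0 < ε) {ι : Type*} (J : Finset ι)
    {v : ι → ℝ → ℝ} (hv : ∀ i ∈ J, Continuous (v i)) {M : ℝ} (hM : ∀ i ∈ J, ∀ t, |v i t| ≤ M)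
    (t : ℝ) :
    timeQuot α ε (fun τ => ∑ i ∈ J, v i τ) t = ∑ i ∈ J, timeQuot α ε (v i) t := by
  unfold timeQuot
  split_ifs
  · simp only [← Finset.sum_sub_distrib, Finset.sum_div]
  · rw [← Finset.mul_sum, ← integral_finsetSum _ fun i hi =>
      integrableOn_timeQuot hα hε (hv i hi) (hM i hi) t]
    simp only [← Finset.sum_sub_distrib, Finset.sum_div]

lemma tendsto_timeQuot {α : ℝ} (hα : 0 < α) (hα1 : α ≤ 1) {v : ℝ → ℝ} (hv : ContDiff ℝ 1 v)
    {M : ℝ} (hM : ∀ t, |v t| ≤ M) (t : ℝ) :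
    Tendsto (fun ε => timeQuot α ε v t) (nhdsWithin 0 (Ioi 0)) (nhds (marchaud α v t)) := by
  unfold timeQuot marchaud
  split_ifs with h
  · have hd : HasDerivAt v (deriv v t) t :=
      (hv.differentiable one_ne_zero t).hasDerivAt
    have h1 := hd.tendsto_slope_zero_left
    have h2 : Tendsto (fun ε : ℝ => -ε) (nhdsWithin 0 (Ioi 0)) (nhdsWithin 0 (Iio 0)) := by
      simpa using tendsto_neg_nhdsGT (a := (0 : ℝ))
    refine (h1.comp h2).congr fun ε => ?_
    simp only [Function.comp, smul_eq_mul, ← sub_eq_add_neg]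
    rw [inv_neg, div_eq_inv_mul]; ring
  · have hα1' := lt_of_le_of_ne hα1 h
    refine Tendsto.const_mul _ ?_
    have hcv : ∫ τ in Iio t, (v t - v τ) / (t - τ) ^ (1 + α) =
        ∫ ρ in Ioi (0 : ℝ), (v t - v (t - ρ)) / ρ ^ (1 + α) := by
      have := (volume.measurePreserving_sub_left t).setIntegral_preimage_emb
        (Homeomorph.subLeft t).measurableEmbedding
        (fun τ => (v t - v τ) / (t - τ) ^ (1 + α)) (Iio t)
      rw [← this]
      have hset : (fun x => t - x) ⁻¹' Iio t = Ioi 0 := by ext; simp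
      rw [hset]
      simp
    rw [hcv]
    obtain ⟨K, hK⟩ := hv.locallyLipschitz.locallyLipschitzOn.exists_lipschitzOnWith_of_compact
      (isCompact_Icc (a := t - 1) (b := t))
    have hK' : ∀ ρ ∈ Ioi (0 : ℝ), |v t - v (t - ρ)| ≤ max (K : ℝ) (2 * M) * min ρ 1 := by
      intro ρ hρ
      have hρ' : (0 : ℝ) < ρ := hρ
      rcases le_total ρ 1 with h1 | h1
      · rw [min_eq_left h1]
        have := hK.dist_le_mul t ⟨by linarith, le_rfl⟩ (t - ρ) ⟨by linarith, by linarith⟩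
        rw [Real.dist_eq, Real.dist_eq, sub_sub_cancel, abs_of_pos hρ'] at this
        exact this.trans (by gcongr; exact le_max_left _ _)
      · rw [min_eq_right h1, mul_one]
        refine le_trans ?_ (le_max_right _ _)
        calc |v t - v (t - ρ)| ≤ |v t| + |v (t - ρ)| := abs_sub _ _
          _ ≤ 2 * M := by linarith [hM t, hM (t - ρ)]
    have hint : IntegrableOn (fun ρ : ℝ => (v t - v (t - ρ)) / ρ ^ (1 + α)) (Ioi 0) := by
      have hvm := hv.continuous.measurable
      refine Integrable.mono' ((integrableOn_min_div_rpow hα hα1').const_mul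
        (max (K : ℝ) (2 * M))) (Measurable.aestronglyMeasurable (by fun_prop)) ?_
      refine (ae_restrict_iff' measurableSet_Ioi).2 (Eventually.of_forall fun ρ hρ => ?_)
      have hρ' : 0 < ρ := hρ
      rw [Real.norm_eq_abs, abs_div, abs_of_pos (Real.rpow_pos_of_pos hρ' _), ← mul_div_assoc]
      gcongr
      exact hK' ρ hρ
    have hcov : AECover (volume.restrict (Ioi (0 : ℝ))) (nhdsWithin (0 : ℝ) (Ioi 0))
        (fun ε : ℝ => Ioi ε) := aecover_Ioi_of_Ioi (tendsto_id.mono_left nhdsWithin_le_nhds)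
    refine (hcov.integral_tendsto_of_countably_generated hint).congr' ?_
    filter_upwards [self_mem_nhdsWithin] with ε hε
    rw [Measure.restrict_restrict measurableSet_Ioi, inter_eq_left.2 (Ioi_subset_Ioi (le_of_lt hε))]

/-- The truncated integral defining the fractional Laplacian. -/
def fracQuot (n : ℕ) (s Cns ε : ℝ) (u : En n → ℝ) (x : En n) : ℝ :=
  Cns * ∫ y in {y : En n | ε ≤ ‖x - y‖}, (u x - u y) / ‖x - y‖ ^ ((n : ℝ) + 2 * s)

lemma fracQuot_eq (n : ℕ) (s Cns ε : ℝ) (u : En n → ℝ) (x : En n) :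
    fracQuot n s Cns ε u x =
      Cns * ∫ z in {z : En n | ε ≤ ‖z‖}, (u x - u (x + z)) * fracKernel n s z := by
  unfold fracQuot
  congr 1
  have := (measurePreserving_add_left (volume : Measure (En n)) x).setIntegral_preimage_emb
    (Homeomorph.addLeft x).measurableEmbedding
    (fun y => (u x - u y) / ‖x - y‖ ^ ((n : ℝ) + 2 * s)) {y : En n | ε ≤ ‖x - y‖}
  rw [← this]
  simp [fracKernel, div_eq_mul_inv]

lemma measurableSet_le_norm {n : ℕ} (r : ℝ) : MeasurableSet {z : En n | r ≤ ‖z‖} :=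
  measurableSet_le measurable_const measurable_norm

lemma integrableOn_mul_fracKernel {n : ℕ} (hn : 1 ≤ n) {s : ℝ} (hs : s ∈ Ioo (0 : ℝ) 1)
    {r : ℝ} (hr : 0 < r) {g : En n → ℝ} (hg : Measurable g) {M : ℝ} (hM : ∀ z, |g z| ≤ M) :
    IntegrableOn (fun z => g z * fracKernel n s z) {z : En n | r ≤ ‖z‖} :=
  Integrable.bdd_mul (integrableOn_fracKernel hn hs hr) hg.aestronglyMeasurable
    (Eventually.of_forall hM)

lemma integrableOn_fracQuot {n : ℕ} (hn : 1 ≤ n) {s : ℝ} (hs : s ∈ Ioo (0 : ℝ) 1)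
    {r : ℝ} (hr : 0 < r) {u : En n → ℝ} (hu : Continuous u) {M : ℝ} (hM : ∀ z, |u z| ≤ M)
    (x : En n) :
    IntegrableOn (fun z => (u x - u (x + z)) * fracKernel n s z) {z : En n | r ≤ ‖z‖} :=
  integrableOn_mul_fracKernel hn hs hr (M := M + M)
    (Continuous.measurable (by fun_prop))
    fun z => (abs_sub _ _).trans (add_le_add (hM _) (hM _))

lemma integral_mul_fracKernel_ge_of_even {n : ℕ} (hn : 1 ≤ n) {s : ℝ} (hs : s ∈ Ioo (0 : ℝ) 1)
    {ε : ℝ} (hε : 0 < ε) {P : En n → ℝ} (hP : Measurable P) {M : ℝ} (hM : ∀ z, |P z| ≤ M)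
    {A R η : ℝ} (hA : 0 ≤ A) (hR : 0 < R) (hη : 0 ≤ η)
    (hle : ∀ z, -(2 * (A * min (‖z‖ ^ 2 / R ^ 2) 1 + η * min (‖z‖ ^ 2) 1)) ≤ P z + P (-z)) :
    -((A * (R ^ (2 * s))⁻¹ + η) * fracMass n s) ≤
      ∫ z in {z : En n | ε ≤ ‖z‖}, P z * fracKernel n s z := by
  have hint := integrableOn_mul_fracKernel hn hs hε hP hM
  have hint' := integrableOn_mul_fracKernel hn hs hε (g := fun z => P (-z))
    (by fun_prop) (fun z => hM (-z))
  have hsym : ∫ z in {z : En n | ε ≤ ‖z‖}, P (-z) * fracKernel n s z =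
      ∫ z in {z : En n | ε ≤ ‖z‖}, P z * fracKernel n s z := by
    have := (Measure.measurePreserving_neg (volume : Measure (En n))).setIntegral_preimage_emb
      (Homeomorph.neg (En n)).measurableEmbedding
      (fun z => P z * fracKernel n s z) {z : En n | ε ≤ ‖z‖}
    rw [← this]
    simp [fracKernel_neg]
  have i1 := (integrable_min_div_mul_fracKernel hn hs hR).const_mul A
  have i2 := (integrable_min_mul_fracKernel hn hs).const_mul η
  have htot : ∫ z in {z : En n | ε ≤ ‖z‖}, (A * (min (‖z‖ ^ 2 / R ^ 2) 1 * fracKernel n s z) +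
      η * (min (‖z‖ ^ 2) 1 * fracKernel n s z)) ≤ (A * (R ^ (2 * s))⁻¹ + η) * fracMass n s := by
    refine (setIntegral_le_integral (i1.add i2) (Eventually.of_forall fun z => ?_)).trans_eq ?_
    · have := fracKernel_nonneg n s z
      simp only [Pi.zero_apply, Pi.add_apply]
      positivity
    · simp only [Pi.add_apply]
      rw [integral_add i1 i2, integral_const_mul, integral_const_mul,
        integral_min_div_mul_fracKernel n s hR]
      simp only [fracMass]
      ring
  have hmain : ∫ z in {z : En n | ε ≤ ‖z‖}, -(2 * (A * (min (‖z‖ ^ 2 / R ^ 2) 1 *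
      fracKernel n s z) + η * (min (‖z‖ ^ 2) 1 * fracKernel n s z))) ≤
      ∫ z in {z : En n | ε ≤ ‖z‖}, (P z * fracKernel n s z + P (-z) * fracKernel n s z) := by
    refine setIntegral_mono (((i1.add i2).const_mul 2).neg).integrableOn (hint.add hint')
      fun z => ?_
    have := mul_le_mul_of_nonneg_right (hle z) (fracKernel_nonneg n s z)
    simp only
    linarith
  rw [integral_neg, integral_const_mul, integral_add hint hint', hsym] at hmain
  linarith

lemma fracQuot_ge {n : ℕ} (hn : 1 ≤ n) {s : ℝ} (hs : s ∈ Ioo (0 : ℝ) 1) {Cns : ℝ}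
    (hC : 0 ≤ Cns) {ε r : ℝ} (hε : 0 < ε) (hεr : ε ≤ r)
    {u : En n → ℝ} (hu : Continuous u) {M : ℝ} (hM : ∀ z, |u z| ≤ M) {x : En n}
    {P B : En n → ℝ} (hP : Measurable P) {MP : ℝ} (hMP : ∀ z, |P z| ≤ MP)
    (hB : Measurable B) {MB : ℝ} (hMB : ∀ z, |B z| ≤ MB)
    (hBn : ∀ z, ‖z‖ ≤ r → 0 ≤ B z)
    {A R η : ℝ} (hA : 0 ≤ A) (hR : 0 < R) (hη : 0 ≤ η)
    (hle : ∀ z, -(2 * (A * min (‖z‖ ^ 2 / R ^ 2) 1 + η * min (‖z‖ ^ 2) 1)) ≤ P z + P (-z))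
    (hu_ge : ∀ z, B z + P z ≤ u x - u (x + z)) :
    Cns * (∫ z in {z : En n | r ≤ ‖z‖}, B z * fracKernel n s z) -
      Cns * ((A * (R ^ (2 * s))⁻¹ + η) * fracMass n s) ≤ fracQuot n s Cns ε u x := by
  have hPk := integral_mul_fracKernel_ge_of_even hn hs hε hP hMP hA hR hη hle
  have iP := integrableOn_mul_fracKernel hn hs hε hP hMP
  have iB := integrableOn_mul_fracKernel hn hs hε hB hMB
  have hsub : {z : En n | r ≤ ‖z‖} ⊆ {z : En n | ε ≤ ‖z‖} := fun z hz => hεr.trans hz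
  have hBk : ∫ z in {z : En n | r ≤ ‖z‖}, B z * fracKernel n s z ≤
      ∫ z in {z : En n | ε ≤ ‖z‖}, B z * fracKernel n s z := by
    have h1 := setIntegral_sdiff (measurableSet_le_norm r) iB hsub
    have h2 : 0 ≤ ∫ z in {z : En n | ε ≤ ‖z‖} \ {z : En n | r ≤ ‖z‖},
        B z * fracKernel n s z := by
      refine setIntegral_nonneg ((measurableSet_le_norm ε).diff (measurableSet_le_norm r))
        fun z hz => mul_nonneg (hBn z ?_) (fracKernel_nonneg n s z)
      have : ¬ r ≤ ‖z‖ := hz.2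
      linarith
    linarith
  have htot : ∫ z in {z : En n | ε ≤ ‖z‖}, (B z * fracKernel n s z + P z * fracKernel n s z) ≤
      ∫ z in {z : En n | ε ≤ ‖z‖}, (u x - u (x + z)) * fracKernel n s z := by
    refine setIntegral_mono (iB.add iP) (integrableOn_fracQuot hn hs hε hu hM x) fun z => ?_
    have := mul_le_mul_of_nonneg_right (hu_ge z) (fracKernel_nonneg n s z)
    simp only
    linarith
  rw [integral_add iB iP] at htot
  rw [fracQuot_eq, ← mul_sub]
  gcongr
  linarith

lemma fracQuot_sub_const (n : ℕ) (s Cns ε : ℝ) (u : En n → ℝ) (c : ℝ) (x : En n) :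
    fracQuot n s Cns ε (fun y => u y - c) x = fracQuot n s Cns ε u x := by
  simp [fracQuot]

lemma fracQuot_const_mul (n : ℕ) (s Cns ε : ℝ) (u : En n → ℝ) (c : ℝ) (x : En n) :
    fracQuot n s Cns ε (fun y => c * u y) x = c * fracQuot n s Cns ε u x := by
  unfold fracQuot
  simp_rw [← mul_sub, mul_div_assoc]
  rw [integral_const_mul]; ring

lemma fracQuot_shift (n : ℕ) (s Cns ε : ℝ) (u : En n → ℝ) (ξ x : En n) :
    fracQuot n s Cns ε (fun y => u (y + ξ)) x = fracQuot n s Cns ε u (x + ξ) := by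
  simp only [fracQuot_eq, add_right_comm]

lemma fracQuot_sub {n : ℕ} (hn : 1 ≤ n) {s : ℝ} (hs : s ∈ Ioo (0 : ℝ) 1) (Cns : ℝ)
    {ε : ℝ} (hε : 0 < ε) {u w : En n → ℝ} (hu : Continuous u) (hw : Continuous w)
    {M N : ℝ} (hM : ∀ z, |u z| ≤ M) (hN : ∀ z, |w z| ≤ N) (x : En n) :
    fracQuot n s Cns ε (fun y => u y - w y) x =
      fracQuot n s Cns ε u x - fracQuot n s Cns ε w x := by
  simp only [fracQuot_eq]
  rw [← mul_sub, ← integral_sub (integrableOn_fracQuot hn hs hε hu hM x)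
    (integrableOn_fracQuot hn hs hε hw hN x)]
  congr 2 with z
  ring

lemma fracQuot_sum {n : ℕ} (hn : 1 ≤ n) {s : ℝ} (hs : s ∈ Ioo (0 : ℝ) 1) (Cns : ℝ)
    {ε : ℝ} (hε : 0 < ε) {ι : Type*} (J : Finset ι) {u : ι → En n → ℝ}
    (hu : ∀ i ∈ J, Continuous (u i)) {M : ℝ} (hM : ∀ i ∈ J, ∀ z, |u i z| ≤ M) (x : En n) :
    fracQuot n s Cns ε (fun y => ∑ i ∈ J, u i y) x = ∑ i ∈ J, fracQuot n s Cns ε (u i) x := by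
  simp only [fracQuot_eq]
  rw [← Finset.mul_sum, ← integral_finsetSum _ fun i hi =>
    integrableOn_fracQuot hn hs hε (hu i hi) (hM i hi) x]
  simp only [← Finset.sum_sub_distrib, Finset.sum_mul]

/-- The second difference quotient approximating the Laplacian. -/
def lapQuot {n : ℕ} (ε : ℝ) (u : En n → ℝ) (x : En n) : ℝ :=
  ∑ i : Fin n, (u (x + ε • eDir i) + u (x - ε • eDir i) - 2 * u x) / ε ^ 2

lemma lapQuot_sub_const {n : ℕ} (ε : ℝ) (u : En n → ℝ) (c : ℝ) (x : En n) :
    lapQuot ε (fun y => u y - c) x = lapQuot ε u x := by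
  simp only [lapQuot]
  congr 1 with i
  ring

lemma lapQuot_const_mul {n : ℕ} (ε : ℝ) (u : En n → ℝ) (c : ℝ) (x : En n) :
    lapQuot ε (fun y => c * u y) x = c * lapQuot ε u x := by
  simp only [lapQuot, Finset.mul_sum]
  congr 1 with i
  ring

lemma lapQuot_shift {n : ℕ} (ε : ℝ) (u : En n → ℝ) (ξ x : En n) :
    lapQuot ε (fun y => u (y + ξ)) x = lapQuot ε u (x + ξ) := by
  simp only [lapQuot, add_right_comm, sub_add_eq_add_sub]

lemma lapQuot_sub {n : ℕ} (ε : ℝ) (u w : En n → ℝ) (x : En n) :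
    lapQuot ε (fun y => u y - w y) x = lapQuot ε u x - lapQuot ε w x := by
  simp only [lapQuot, ← Finset.sum_sub_distrib]
  congr 1 with i
  ring

lemma lapQuot_sum {n : ℕ} (ε : ℝ) {ι : Type*} (J : Finset ι) (u : ι → En n → ℝ) (x : En n) :
    lapQuot ε (fun y => ∑ i ∈ J, u i y) x = ∑ i ∈ J, lapQuot ε (u i) x := by
  simp only [lapQuot]
  rw [Finset.sum_comm]
  simp only [Finset.mul_sum, ← Finset.sum_sub_distrib, ← Finset.sum_add_distrib, Finset.sum_div]

lemma tendsto_second_difference {E : Type*} [NormedAddCommGroup E] [NormedSpace ℝ E]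
    {f : E → ℝ} {x : E} (hf : ContDiffAt ℝ 2 f x) (e : E) :
    Tendsto (fun ε : ℝ => (f (x + ε • e) + f (x - ε • e) - 2 * f x) / ε ^ 2)
      (nhdsWithin 0 (Ioi 0)) (nhds (iteratedFDeriv ℝ 2 f x fun _ => e)) := by
  rw [iteratedFDeriv_two_apply]
  obtain ⟨L, hL⟩ : ∃ L, L = fderiv ℝ (fderiv ℝ f) x e e := ⟨_, rfl⟩
  rw [← hL]
  have hlin : ∀ c : ℝ, Tendsto (fun ε : ℝ => x + (c * ε) • e) (nhds 0) (nhds x) := by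
    intro c
    have : Continuous (fun ε : ℝ => x + (c * ε) • e) := by fun_prop
    simpa using this.tendsto 0
  have hdiff : ∀ᶠ y in nhds x, DifferentiableAt ℝ f y := by
    filter_upwards [hf.eventually (by simp)] with y hy
    exact hy.differentiableAt two_ne_zero
  have hder : ∀ (c ε : ℝ), DifferentiableAt ℝ f (x + (c * ε) • e) →
      HasDerivAt (fun ε : ℝ => f (x + (c * ε) • e)) (c * fderiv ℝ f (x + (c * ε) • e) e) ε := by
    intro c ε hd
    have h1 : HasDerivAt (fun ε : ℝ => x + (c * ε) • e) (c • e) ε := by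
      simpa using (((hasDerivAt_id ε).const_mul c).smul_const e).const_add x
    have h2 := hd.hasFDerivAt.comp_hasDerivAt ε h1
    rw [map_smul, smul_eq_mul] at h2
    exact h2
  have hd2 : HasFDerivAt (fderiv ℝ f) (fderiv ℝ (fderiv ℝ f) x) x :=
    ((hf.fderiv_right (m := 1) (by norm_num)).differentiableAt one_ne_zero).hasFDerivAt
  have hφ : ∀ c : ℝ, HasDerivAt (fun ε : ℝ => fderiv ℝ f (x + (c * ε) • e) e) (c * L) 0 := by
    intro c
    have h1 : HasDerivAt (fun ε : ℝ => x + (c * ε) • e) (c • e) 0 := by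
      simpa using (((hasDerivAt_id (0 : ℝ)).const_mul c).smul_const e).const_add x
    have h2 : HasFDerivAt (fun y => fderiv ℝ f y e)
        ((ContinuousLinearMap.apply ℝ ℝ e).comp (fderiv ℝ (fderiv ℝ f) x))
        (x + (c * (0 : ℝ)) • e) := by
      rw [mul_zero, zero_smul, add_zero]
      exact (ContinuousLinearMap.apply ℝ ℝ e).hasFDerivAt.comp x hd2
    have h3 := h2.comp_hasDerivAt (0 : ℝ) h1
    rw [map_smul, smul_eq_mul] at h3
    rw [hL]
    exact h3
  have hcore : Tendsto (fun ε : ℝ => (f (x + (1 * ε) • e) + f (x + (-1 * ε) • e) - 2 * f x) / ε ^ 2)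
      (nhdsWithin 0 (Ioi 0)) (nhds L) := by
    refine HasDerivAt.lhopital_zero_nhdsGT
      (f' := fun ε => 1 * fderiv ℝ f (x + (1 * ε) • e) e +
        -1 * fderiv ℝ f (x + (-1 * ε) • e) e)
      (g' := fun ε => 2 * ε) ?_ ?_ ?_ ?_ ?_ ?_
    · filter_upwards [((hlin 1).mono_left nhdsWithin_le_nhds).eventually hdiff,
        ((hlin (-1)).mono_left nhdsWithin_le_nhds).eventually hdiff] with ε h1 h2
      exact ((hder 1 ε h1).add (hder (-1) ε h2)).sub_const _
    · exact Eventually.of_forall fun ε => by simpa using hasDerivAt_pow 2 ε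
    · filter_upwards [self_mem_nhdsWithin] with ε hε
      have : (0 : ℝ) < ε := hε
      positivity
    · have hc : ∀ c : ℝ, Tendsto (fun ε : ℝ => f (x + (c * ε) • e)) (nhdsWithin 0 (Ioi 0))
          (nhds (f x)) := fun c =>
        hf.continuousAt.tendsto.comp ((hlin c).mono_left nhdsWithin_le_nhds)
      have := ((hc 1).add (hc (-1))).sub_const (2 * f x)
      convert this using 2
      ring
    · have : Continuous fun ε : ℝ => ε ^ 2 := by fun_prop
      simpa using (this.tendsto 0).mono_left nhdsWithin_le_nhds
    · have h1 := ((hφ 1).sub (hφ (-1))).tendsto_slope_zero_right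
      have h2 := h1.const_mul (1 / 2 : ℝ)
      have h3 : (1 / 2 : ℝ) * (1 * L - -1 * L) = L := by ring
      rw [h3] at h2
      refine h2.congr fun ε => ?_
      simp only [Pi.sub_apply, zero_add, mul_zero, zero_smul, add_zero, sub_self, sub_zero,
        smul_eq_mul]
      rw [div_eq_inv_mul _ (2 * ε), mul_inv]; ring
  refine hcore.congr fun ε => ?_
  rw [one_mul, neg_one_mul, neg_smul, ← sub_eq_add_neg]

lemma tendsto_lapQuot {n : ℕ} {u : En n → ℝ} {x : En n} (hu : ContDiffAt ℝ 2 u x) :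
    Tendsto (fun ε => lapQuot ε u x) (nhdsWithin 0 (Ioi 0)) (nhds (lap u x)) :=
  tendsto_finsetSum _ fun i _ => tendsto_second_difference hu (eDir i)

/-- Bounded functions of space and time which are continuous in each variable separately. -/
structure SepContBdd {n : ℕ} (W : En n → ℝ → ℝ) : Prop where
  cont_space : ∀ t, Continuous fun x => W x t
  cont_time : ∀ x, Continuous (W x)
  bdd : ∃ M, ∀ x t, |W x t| ≤ M

lemma SepContBdd.shift {n : ℕ} {W : En n → ℝ → ℝ} (hW : SepContBdd W) (ξ : En n) (a : ℝ) :
    SepContBdd fun x t => W (x + ξ) (t + a) where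
  cont_space t := (hW.cont_space (t + a)).comp (by fun_prop : Continuous fun x => x + ξ)
  cont_time x := (hW.cont_time (x + ξ)).comp (by fun_prop : Continuous fun t => t + a)
  bdd := hW.bdd.imp fun _ hM x t => hM (x + ξ) (t + a)

lemma SepContBdd.sub {n : ℕ} {V W : En n → ℝ → ℝ} (hV : SepContBdd V) (hW : SepContBdd W) :
    SepContBdd fun x t => V x t - W x t where
  cont_space t := (hV.cont_space t).sub (hW.cont_space t)
  cont_time x := (hV.cont_time x).sub (hW.cont_time x)
  bdd := by
    obtain ⟨M, hM⟩ := hV.bdd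
    obtain ⟨N, hN⟩ := hW.bdd
    exact ⟨M + N, fun x t => (abs_sub _ _).trans (add_le_add (hM x t) (hN x t))⟩

lemma SepContBdd.sub_const {n : ℕ} {W : En n → ℝ → ℝ} (hW : SepContBdd W) (c : ℝ) :
    SepContBdd fun x t => W x t - c :=
  hW.sub ⟨fun _ => continuous_const, fun _ => continuous_const, |c|, fun _ _ => le_rfl⟩

lemma SepContBdd.const_mul_sum {n : ℕ} {W : En n → ℝ → ℝ} (hW : SepContBdd W) (c : ℝ)
    {ι : Type*} (J : Finset ι) (a : ι → ℝ) :
    SepContBdd fun x t => c * ∑ i ∈ J, W x (t - a i) where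
  cont_space t := (continuous_finsetSum J fun i _ => hW.cont_space _).const_mul c
  cont_time x := (continuous_finsetSum J fun i _ => (hW.cont_time x).comp
    (by fun_prop : Continuous fun t => t - a i)).const_mul c
  bdd := by
    obtain ⟨M, hM⟩ := hW.bdd
    refine ⟨|c| * ∑ _i ∈ J, M, fun x t => ?_⟩
    rw [abs_mul]
    gcongr
    exact (Finset.abs_sum_le_sum_abs _ _).trans (Finset.sum_le_sum fun i _ => hM _ _)

/-- The truncated version of the operator `∂ₜᵅ + (-Δ)ˢ - Δ`. -/
def opQuot (α : ℝ) (n : ℕ) (s Cns ε : ℝ) (W : En n → ℝ → ℝ) (x : En n) (t : ℝ) : ℝ :=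
  timeQuot α ε (W x) t + fracQuot n s Cns ε (fun y => W y t) x - lapQuot ε (fun y => W y t) x

lemma opQuot_shift (α : ℝ) (n : ℕ) (s Cns ε : ℝ) (W : En n → ℝ → ℝ) (ξ x : En n) (a t : ℝ) :
    opQuot α n s Cns ε (fun y τ => W (y + ξ) (τ + a)) x t =
      opQuot α n s Cns ε W (x + ξ) (t + a) := by
  unfold opQuot
  rw [timeQuot_shift α ε (W (x + ξ)), fracQuot_shift n s Cns ε (fun y => W y (t + a)),
    lapQuot_shift ε (fun y => W y (t + a))]

lemma opQuot_sub {α : ℝ} (hα : 0 < α) {n : ℕ} (hn : 1 ≤ n) {s : ℝ} (hs : s ∈ Ioo (0 : ℝ) 1)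
    (Cns : ℝ) {ε : ℝ} (hε : 0 < ε) {V W : En n → ℝ → ℝ} (hV : SepContBdd V) (hW : SepContBdd W)
    (x : En n) (t : ℝ) :
    opQuot α n s Cns ε (fun y τ => V y τ - W y τ) x t =
      opQuot α n s Cns ε V x t - opQuot α n s Cns ε W x t := by
  obtain ⟨M, hM⟩ := hV.bdd
  obtain ⟨N, hN⟩ := hW.bdd
  unfold opQuot
  rw [timeQuot_sub hα hε (hV.cont_time x) (hW.cont_time x) (hM x) (hN x),
    fracQuot_sub hn hs Cns hε (hV.cont_space t) (hW.cont_space t) (fun z => hM z t)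
      (fun z => hN z t), lapQuot_sub ε (fun y => V y t)]
  ring

lemma opQuot_const_mul_sum {α : ℝ} (hα : 0 < α) {n : ℕ} (hn : 1 ≤ n) {s : ℝ}
    (hs : s ∈ Ioo (0 : ℝ) 1) (Cns : ℝ) {ε : ℝ} (hε : 0 < ε) {W : En n → ℝ → ℝ}
    (hW : SepContBdd W) (b c : ℝ) {ι : Type*} (J : Finset ι) (a : ι → ℝ) (x : En n) (t : ℝ) :
    opQuot α n s Cns ε (fun y τ => b * ∑ i ∈ J, (W y (τ - a i) - c)) x t =
      b * ∑ i ∈ J, opQuot α n s Cns ε W x (t - a i) := by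
  obtain ⟨M, hM⟩ := (hW.sub_const c).bdd
  unfold opQuot
  rw [timeQuot_const_mul α ε (fun τ => ∑ i ∈ J, (W x (τ - a i) - c)),
    timeQuot_sum hα hε J (v := fun i τ => W x (τ - a i) - c)
      (fun i _ => ((hW.sub_const c).cont_time x).comp
        (by fun_prop : Continuous fun τ => τ - a i)) (fun i _ τ => hM x (τ - a i)),
    fracQuot_const_mul n s Cns ε (fun y => ∑ i ∈ J, (W y (t - a i) - c)),
    fracQuot_sum hn hs Cns hε J (u := fun i y => W y (t - a i) - c)
      (fun i _ => (hW.sub_const c).cont_space (t - a i)) (fun i _ y => hM y (t - a i)),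
    lapQuot_const_mul ε (fun y => ∑ i ∈ J, (W y (t - a i) - c)),
    lapQuot_sum ε J (fun i y => W y (t - a i) - c), ← mul_add, ← mul_sub,
    ← Finset.sum_add_distrib, ← Finset.sum_sub_distrib]
  congr 1
  refine Finset.sum_congr rfl fun i _ => ?_
  rw [timeQuot_sub_const α ε (fun τ => W x (τ - a i)), fracQuot_sub_const n s Cns ε
    (fun y => W y (t - a i)), lapQuot_sub_const ε (fun y => W y (t - a i))]
  simp_rw [sub_eq_add_neg _ (a i)]
  rw [timeQuot_shift α ε (W x)]

/-- The cost of a unit cut-off at space scale `R` and time scale `T`. -/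
def cutoffCost (α : ℝ) (n : ℕ) (s Cns R T : ℝ) : ℝ :=
  timeConst α * (T ^ α)⁻¹ + Cns * ((R ^ (2 * s))⁻¹ * fracMass n s) + n * (2 / R ^ 2)

lemma opQuot_ge {α : ℝ} (hα : 0 < α) (hα1 : α ≤ 1) {n : ℕ} (hn : 1 ≤ n) {s : ℝ}
    (hs : s ∈ Ioo (0 : ℝ) 1) {Cns : ℝ} (hC : 0 ≤ Cns) {ε r : ℝ} (hε : 0 < ε) (hεr : ε ≤ r)
    {W : En n → ℝ → ℝ} (hW : SepContBdd W) {x : En n} {t : ℝ}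
    {P B : En n → ℝ} (hP : Measurable P) {MP : ℝ} (hMP : ∀ z, |P z| ≤ MP)
    (hB : Measurable B) {MB : ℝ} (hMB : ∀ z, |B z| ≤ MB)
    (hBn : ∀ z, ‖z‖ ≤ r → 0 ≤ B z)
    {A R T η : ℝ} (hA : 0 ≤ A) (hR : 0 < R) (hT : 0 < T) (hη : 0 ≤ η)
    (hle : ∀ z, -(2 * (A * min (‖z‖ ^ 2 / R ^ 2) 1 + η * min (‖z‖ ^ 2) 1)) ≤ P z + P (-z))
    (hspace : ∀ z, B z + P z ≤ W x t - W (x + z) t)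
    (htime : ∀ ρ, 0 < ρ → -(A * min (ρ / T) 1) ≤ W x t - W x (t - ρ)) :
    Cns * (∫ z in {z : En n | r ≤ ‖z‖}, B z * fracKernel n s z) -
      (A * cutoffCost α n s Cns R T + η * (Cns * fracMass n s + 2 * n)) ≤
      opQuot α n s Cns ε W x t := by
  obtain ⟨M, hM⟩ := hW.bdd
  have h1 := timeQuot_ge hα hα1 hε (hW.cont_time x) (hM x) hA hT htime
  have h2 := fracQuot_ge hn hs hC hε hεr (hW.cont_space t) (fun z => hM z t) hP hMP hB hMB hBn
    hA hR hη hle hspace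
  have h3 : lapQuot ε (fun y => W y t) x ≤ n * (2 * (A / R ^ 2 + η)) := by
    unfold lapQuot
    refine (Finset.sum_le_card_nsmul _ _ (2 * (A / R ^ 2 + η)) fun i _ => ?_).trans_eq (by simp)
    have hnorm : ‖ε • (eDir i : En n)‖ = ε := by
      simp [eDir, norm_smul, abs_of_pos hε]
    set z : En n := ε • eDir i with hz
    rw [div_le_iff₀ (by positivity)]
    have e1 := hspace z
    have e2 := hspace (-z)
    have e3 := hBn z (by rw [hnorm]; exact hεr)
    have e4 := hBn (-z) (by rw [norm_neg, hnorm]; exact hεr)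
    have e5 := hle z
    rw [hnorm] at e5
    have e6 : A * min (ε ^ 2 / R ^ 2) 1 ≤ A * (ε ^ 2 / R ^ 2) := by
      gcongr; exact min_le_left _ _
    have e7 : η * min (ε ^ 2) 1 ≤ η * ε ^ 2 := by gcongr; exact min_le_left _ _
    rw [← sub_eq_add_neg] at e2
    have e8 : 2 * (A / R ^ 2 + η) * ε ^ 2 = 2 * (A * (ε ^ 2 / R ^ 2) + η * ε ^ 2) := by ring
    linarith
  unfold opQuot cutoffCost
  have e9 : A * (timeConst α * (T ^ α)⁻¹ + Cns * ((R ^ (2 * s))⁻¹ * fracMass n s) +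
      n * (2 / R ^ 2)) + η * (Cns * fracMass n s + 2 * n) =
      A * timeConst α * (T ^ α)⁻¹ + Cns * ((A * (R ^ (2 * s))⁻¹ + η) * fracMass n s) +
      n * (2 * (A / R ^ 2 + η)) := by ring
  linarith

/-- The average of `f` over `[t - θ, t]`. -/
def backAvg (θ : ℝ) (f : ℝ → ℝ) (t : ℝ) : ℝ := θ⁻¹ * ∫ r in (t - θ)..t, f r

/-- The Riemann sum with `m` points of the average of `f` over `[t - θ, t]`. -/
def backSum (θ : ℝ) (m : ℕ) (f : ℝ → ℝ) (t : ℝ) : ℝ :=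
  (m : ℝ)⁻¹ * ∑ i ∈ Finset.range m, f (t - θ * i / m)

lemma mul_div_mem_Ico {θ : ℝ} (hθ : 0 < θ) {m i : ℕ} (hi : i < m) :
    θ * i / m ∈ Ico 0 θ := by
  have hm : (0 : ℝ) < m := by exact_mod_cast (Nat.zero_le i).trans_lt hi
  have hi' : (i : ℝ) < m := by exact_mod_cast hi
  refine ⟨by positivity, ?_⟩
  rw [div_lt_iff₀ hm]
  gcongr

lemma backSum_le {θ : ℝ} {m : ℕ} (hm : 0 < m) {f : ℝ → ℝ} {t C : ℝ}
    (h : ∀ r, f r ≤ C) : backSum θ m f t ≤ C := by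
  have hm' : (0 : ℝ) < m := by exact_mod_cast hm
  unfold backSum
  rw [inv_mul_le_iff₀ hm']
  refine (Finset.sum_le_card_nsmul _ _ C fun i _ => h _).trans_eq ?_
  simp

lemma backSum_nonneg {θ : ℝ} {m : ℕ} {f : ℝ → ℝ} {t : ℝ} (h : ∀ r, 0 ≤ f r) :
    0 ≤ backSum θ m f t :=
  mul_nonneg (by positivity) (Finset.sum_nonneg fun i _ => h _)

lemma backAvg_le {θ : ℝ} (hθ : 0 < θ) {f : ℝ → ℝ} (hf : Continuous f) {t C : ℝ}
    (h : ∀ r, f r ≤ C) : backAvg θ f t ≤ C := by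
  unfold backAvg
  rw [inv_mul_le_iff₀ hθ]
  have := intervalIntegral.integral_mono_on (μ := volume) (a := t - θ) (b := t) (by linarith)
    (hf.intervalIntegrable (t - θ) t) (continuous_const.intervalIntegrable (t - θ) t)
    (fun r _ => h r)
  simpa using this

lemma backAvg_ge {θ : ℝ} (hθ : 0 < θ) {f : ℝ → ℝ} (hf : Continuous f) {t C : ℝ}
    (h : ∀ r ∈ Icc (t - θ) t, C ≤ f r) : C ≤ backAvg θ f t := by
  unfold backAvg
  rw [le_inv_mul_iff₀ hθ]
  have := intervalIntegral.integral_mono_on (μ := volume) (a := t - θ) (b := t) (by linarith)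
    (continuous_const.intervalIntegrable (t - θ) t) (hf.intervalIntegrable (t - θ) t) h
  simpa using this

lemma abs_backSum_sub_backAvg_le {θ : ℝ} (hθ : 0 < θ) {m : ℕ} (hm : 0 < m) {f : ℝ → ℝ}
    (hf : Continuous f) {t δ : ℝ}
    (h : ∀ a ∈ Icc (t - θ) t, ∀ b ∈ Icc (t - θ) t, |a - b| ≤ θ / m → |f a - f b| ≤ δ) :
    |backSum θ m f t - backAvg θ f t| ≤ δ := by
  have hm' : (0 : ℝ) < m := by exact_mod_cast hm
  have hadj := intervalIntegral.sum_integral_adjacent_intervals (f := f) (μ := volume)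
    (a := fun i : ℕ => t - θ * i / m) (n := m) (fun i _ => hf.intervalIntegrable _ _)
  have hend : t - θ * (m : ℝ) / m = t - θ := by field_simp
  simp only [Nat.cast_zero, mul_zero, zero_div, sub_zero, hend] at hadj
  rw [intervalIntegral.integral_symm] at hadj
  have hterm : ∀ i ∈ Finset.range m,
      |θ / m * f (t - θ * i / m) + ∫ r in (t - θ * i / m)..(t - θ * (i + 1 : ℕ) / m), f r|
        ≤ θ / m * δ := by
    intro i hi
    have hi' := Finset.mem_range.1 hi
    have hlen : t - θ * i / m - (t - θ * (i + 1 : ℕ) / m) = θ / m := by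
      push_cast; ring
    have hpos : 0 < θ / m := by positivity
    have hmem := mul_div_mem_Ico hθ hi'
    have hlow : t - θ ≤ t - θ * (i + 1 : ℕ) / m := by
      have : θ * (i + 1 : ℕ) / m ≤ θ := by
        rw [div_le_iff₀ hm']
        gcongr
        exact_mod_cast hi'
      linarith
    have hconst : θ / m * f (t - θ * i / m) =
        ∫ r in (t - θ * (i + 1 : ℕ) / m)..(t - θ * i / m), f (t - θ * i / m) := by
      rw [intervalIntegral.integral_const, hlen, smul_eq_mul]
    rw [intervalIntegral.integral_symm, ← sub_eq_add_neg, hconst,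
      ← intervalIntegral.integral_sub (continuous_const.intervalIntegrable _ _)
        (hf.intervalIntegrable _ _)]
    have := intervalIntegral.norm_integral_le_of_norm_le_const
      (a := t - θ * (i + 1 : ℕ) / m) (b := t - θ * i / m) (C := δ)
      (f := fun r => f (t - θ * i / m) - f r) ?_
    · rw [hlen, abs_of_pos hpos, Real.norm_eq_abs] at this
      linarith
    · intro r hr
      rw [uIoc_of_le (by linarith)] at hr
      refine h _ ⟨by linarith [hmem.2], by linarith [hmem.1]⟩ r
        ⟨by linarith [hr.1], by linarith [hr.2, hmem.1]⟩ ?_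
      rw [abs_of_nonneg (by linarith [hr.2])]
      linarith [hr.1]
  have heq : backSum θ m f t - backAvg θ f t = θ⁻¹ * ∑ i ∈ Finset.range m,
      (θ / m * f (t - θ * i / m) + ∫ r in (t - θ * i / m)..(t - θ * (i + 1 : ℕ) / m), f r) := by
    rw [Finset.sum_add_distrib, hadj, ← Finset.mul_sum]
    unfold backSum backAvg
    field_simp
    ring
  rw [heq, abs_mul, abs_of_pos (by positivity), inv_mul_le_iff₀ hθ]
  refine (Finset.abs_sum_le_sum_abs _ _).trans ((Finset.sum_le_card_nsmul _ _ _ hterm).trans_eq ?_)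
  simp only [Finset.card_range, nsmul_eq_mul]
  field_simp

lemma eventually_abs_backSum_sub_backAvg_le {X : Type*} [PseudoMetricSpace X] {Y : X → ℝ → ℝ}
    (hY : ∀ x, Continuous (Y x)) {θ a b : ℝ} (hθ : 0 < θ) {K : Set X} (hK : IsCompact K)
    (hc : ContinuousOn (fun p : X × ℝ => Y p.1 p.2) (K ×ˢ Icc (a - θ) b)) {δ : ℝ} (hδ : 0 < δ) :
    ∀ᶠ m : ℕ in atTop, ∀ x ∈ K, ∀ t ∈ Icc a b,
      |backSum θ m (Y x) t - backAvg θ (Y x) t| ≤ δ := by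
  have hu := (hK.prod isCompact_Icc).uniformContinuousOn_of_continuous hc
  rw [Metric.uniformContinuousOn_iff] at hu
  obtain ⟨γ, hγ, hu⟩ := hu δ hδ
  have hlim : Tendsto (fun m : ℕ => θ / (m : ℝ)) atTop (nhds 0) :=
    tendsto_const_div_atTop_nhds_zero_nat θ
  filter_upwards [hlim.eventually (gt_mem_nhds hγ), eventually_gt_atTop 0] with m hm hm0
  intro x hx t ht
  refine abs_backSum_sub_backAvg_le hθ hm0 (hY x) fun r hr r' hr' hrr => ?_
  have h1 := hu (x, r) ⟨hx, ⟨by linarith [hr.1, ht.1], hr.2.trans ht.2⟩⟩ (x, r')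
    ⟨hx, ⟨by linarith [hr'.1, ht.1], hr'.2.trans ht.2⟩⟩
    (by rw [Prod.dist_eq, dist_self, Real.dist_eq]; exact max_lt hγ (hrr.trans_lt hm))
  exact h1.le

lemma tendsto_backSum {f : ℝ → ℝ} (hf : Continuous f) {θ a b : ℝ} (hθ : 0 < θ) {t : ℕ → ℝ}
    (ht : ∀ᶠ m in atTop, t m ∈ Icc a b) :
    Tendsto (fun m => |backSum θ m f (t m) - backAvg θ f (t m)|) atTop (nhds 0) := by
  rw [Metric.tendsto_nhds]
  intro δ hδ
  filter_upwards [eventually_abs_backSum_sub_backAvg_le (X := Unit) (Y := fun _ => f)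
    (fun _ => hf) (a := a) (b := b) hθ isCompact_univ
    (hf.comp continuous_snd).continuousOn (half_pos hδ), ht] with m hm htm
  have := hm () trivial (t m) htm
  rw [Real.dist_eq, sub_zero, abs_abs]
  linarith

lemma continuous_backAvg {n : ℕ} {Y : En n → ℝ → ℝ} (hY : SepContBdd Y) {θ : ℝ} (hθ : 0 < θ) :
    Continuous fun p : En n × ℝ => backAvg θ (Y p.1) p.2 := by
  obtain ⟨M, hM⟩ := hY.bdd
  have hM0 : 0 ≤ M := (abs_nonneg _).trans (hM 0 0)
  refine continuous_prod_of_continuous_lipschitzWith' _ (θ⁻¹ * (2 * M)).toNNReal (fun x => ?_)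
    fun t => ?_
  · refine LipschitzWith.of_dist_le_mul fun t t' => ?_
    have hi : ∀ a b, IntervalIntegrable (Y x) volume a b := fun a b =>
      (hY.cont_time x).intervalIntegrable a b
    have hb : ∀ a b, |∫ r in a..b, Y x r| ≤ M * |b - a| := fun a b =>
      intervalIntegral.norm_integral_le_of_norm_le_const (f := Y x) fun r _ => hM x r
    have hsplit : (∫ r in (t - θ)..t, Y x r) - ∫ r in (t' - θ)..t', Y x r =
        (∫ r in t'..t, Y x r) - ∫ r in (t' - θ)..(t - θ), Y x r := by
      rw [← intervalIntegral.integral_add_adjacent_intervals (hi (t - θ) t') (hi t' t),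
        ← intervalIntegral.integral_add_adjacent_intervals (hi (t' - θ) (t - θ)) (hi (t - θ) t')]
      ring
    rw [Real.coe_toNNReal _ (by positivity), Real.dist_eq, Real.dist_eq]
    unfold backAvg
    rw [← mul_sub, hsplit, abs_mul, abs_of_pos (inv_pos.2 hθ), mul_assoc]
    gcongr
    refine (abs_sub _ _).trans ((add_le_add (hb _ _) (hb _ _)).trans_eq ?_)
    rw [sub_sub_sub_cancel_right]; ring
  · change Continuous fun x => θ⁻¹ * ∫ r in (t - θ)..t, Y x r
    refine continuous_const.mul (intervalIntegral.continuous_of_dominated_interval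
      (bound := fun _ => M) (fun x => ?_) (fun x => ?_) ?_ ?_)
    · exact (hY.cont_time x).aestronglyMeasurable
    · exact Eventually.of_forall fun r _ => hM x r
    · exact continuous_const.intervalIntegrable _ _
    · exact Eventually.of_forall fun r _ => hY.cont_space r

lemma SepContBdd.posPart {n : ℕ} {w : En n → ℝ → ℝ} (hw : SepContBdd w) (c : ℝ) :
    SepContBdd fun x t => max (w x t - c) 0 where
  cont_space t := ((hw.sub_const c).cont_space t).max continuous_const
  cont_time x := ((hw.sub_const c).cont_time x).max continuous_const
  bdd := by
    obtain ⟨M, hM⟩ := (hw.sub_const c).bdd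
    refine ⟨M, fun x t => ?_⟩
    have h1 := hM x t
    rw [abs_of_nonneg (le_max_right _ _)]
    exact max_le ((le_abs_self _).trans h1) ((abs_nonneg _).trans h1)

lemma SepContBdd.backSum {n : ℕ} {Y : En n → ℝ → ℝ} (hY : SepContBdd Y) (θ : ℝ) (m : ℕ) :
    SepContBdd fun x t => backSum θ m (Y x) t :=
  hY.const_mul_sum _ _ _

/-- A truncated quadratic penalty of height `A` and width `R` centred at `x₀`. -/
def spaceCut {n : ℕ} (x₀ : En n) (R A : ℝ) (x : En n) : ℝ := A * min (‖x - x₀‖ ^ 2 / R ^ 2) 1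

/-- A truncated linear penalty of height `A` and width `T` centred at `t₀`. -/
def timeCut (t₀ T A t : ℝ) : ℝ := A * min (|t - t₀| / T) 1

lemma continuous_spaceCut {n : ℕ} (x₀ : En n) (R A : ℝ) : Continuous (spaceCut x₀ R A) := by
  unfold spaceCut; fun_prop

lemma continuous_timeCut (t₀ T A : ℝ) : Continuous (timeCut t₀ T A) := by
  unfold timeCut; fun_prop

lemma spaceCut_nonneg {n : ℕ} (x₀ : En n) (R : ℝ) {A : ℝ} (hA : 0 ≤ A) (x : En n) :
    0 ≤ spaceCut x₀ R A x := by
  unfold spaceCut; positivity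

lemma spaceCut_le {n : ℕ} (x₀ : En n) (R : ℝ) {A : ℝ} (hA : 0 ≤ A) (x : En n) :
    spaceCut x₀ R A x ≤ A :=
  mul_le_of_le_one_right hA (min_le_right _ _)

lemma timeCut_nonneg (t₀ : ℝ) {T A : ℝ} (hT : 0 < T) (hA : 0 ≤ A) (t : ℝ) :
    0 ≤ timeCut t₀ T A t := by
  unfold timeCut; positivity

lemma spaceCut_self {n : ℕ} (x₀ : En n) (R A : ℝ) : spaceCut x₀ R A x₀ = 0 := by
  simp [spaceCut]

lemma timeCut_self (t₀ T A : ℝ) : timeCut t₀ T A t₀ = 0 := by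
  simp [timeCut]

lemma spaceCut_of_notMem {n : ℕ} {x₀ x : En n} {R : ℝ} (hR : 0 < R) (A : ℝ)
    (hx : x ∉ Metric.closedBall x₀ R) : spaceCut x₀ R A x = A := by
  rw [Metric.mem_closedBall, dist_eq_norm, not_le] at hx
  unfold spaceCut
  rw [min_eq_right, mul_one]
  rw [one_le_div (by positivity)]
  gcongr

lemma timeCut_of_notMem {t₀ t T : ℝ} (hT : 0 < T) (A : ℝ)
    (ht : t ∉ Icc (t₀ - T) (t₀ + T)) : timeCut t₀ T A t = A := by
  unfold timeCut
  rw [min_eq_right, mul_one]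
  rw [one_le_div hT]
  by_contra! h
  rw [abs_lt] at h
  exact ht ⟨by linarith, by linarith⟩

lemma spaceCut_second_difference {n : ℕ} (x₀ : En n) {R A : ℝ} (hR : 0 < R) (hA : 0 ≤ A)
    (x z : En n) :
    -(2 * (A * min (‖z‖ ^ 2 / R ^ 2) 1)) ≤
      (spaceCut x₀ R A x - spaceCut x₀ R A (x + z)) +
        (spaceCut x₀ R A x - spaceCut x₀ R A (x + -z)) := by
  have h := mul_le_mul_of_nonneg_left (min_sq_div_second_difference hR (x - x₀) z) hA
  unfold spaceCut
  rw [add_sub_right_comm, ← sub_eq_add_neg, sub_right_comm]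
  linarith

lemma timeCut_sub_ge (t₀ : ℝ) {T A : ℝ} (hT : 0 < T) (hA : 0 ≤ A) (t : ℝ) {ρ : ℝ} (hρ : 0 < ρ) :
    -(A * min (ρ / T) 1) ≤ timeCut t₀ T A t - timeCut t₀ T A (t - ρ) := by
  have h1 : |t - ρ - t₀| / T ≤ |t - t₀| / T + ρ / T := by
    rw [← add_div]
    gcongr
    calc |t - ρ - t₀| = |(t - t₀) - ρ| := by ring_nf
      _ ≤ |t - t₀| + |ρ| := abs_sub _ _
      _ = _ := by rw [abs_of_pos hρ]
  have h2 : 0 ≤ |t - t₀| / T := by positivity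
  have h3 : 0 ≤ ρ / T := by positivity
  have h4 : min (|t - ρ - t₀| / T) 1 ≤ min (|t - t₀| / T) 1 + min (ρ / T) 1 := by
    have a1 := min_le_left (|t - ρ - t₀| / T) 1
    have a2 := min_le_right (|t - ρ - t₀| / T) 1
    rcases min_cases (|t - t₀| / T) 1 with ⟨h, h'⟩ | ⟨h, h'⟩ <;>
    rcases min_cases (ρ / T) 1 with ⟨g, g'⟩ | ⟨g, g'⟩ <;> rw [h, g] <;> linarith
  have h5 := mul_le_mul_of_nonneg_left h4 hA
  unfold timeCut
  linarith

lemma integral_mul_fracKernel_tail_ge {n : ℕ} (hn : 1 ≤ n) {s : ℝ} (hs : s ∈ Ioo (0 : ℝ) 1)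
    {d : ℝ} (hd : 0 < d) {a : En n} (ha : ‖a‖ ≤ d / 2) {D : Set (En n)} (hD : MeasurableSet D)
    (hDd : D ⊆ {z | d / 2 ≤ ‖z‖}) {B g N : En n → ℝ} (hB : Measurable B) {MB : ℝ}
    (hMB : ∀ z, |B z| ≤ MB) (hg : Measurable g) {Mg : ℝ} (hMg : ∀ z, |g z| ≤ Mg)
    (hN : Measurable N) {MN : ℝ} (hMN : ∀ z, |N z| ≤ MN)
    (hNn : ∀ z, 0 ≤ N z) (hBD : ∀ z ∈ D, g z ≤ B z) (hBn : ∀ z, ‖z + a‖ ≤ d → 0 ≤ B z)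
    (hBN : ∀ z, -N (z + a) ≤ B z) :
    (∫ z in D, g z * fracKernel n s z) - 2 ^ ((n : ℝ) + 2 * s) *
      (∫ v in {v : En n | d ≤ ‖v‖}, N v * fracKernel n s v) ≤
      ∫ z in {z : En n | d / 2 ≤ ‖z‖}, B z * fracKernel n s z := by
  have hd2 : 0 < d / 2 := by positivity
  set q : ℝ := (n : ℝ) + 2 * s with hq
  have hq0 : 0 < q := by have := hs.1; positivity
  have ig := (integrableOn_mul_fracKernel hn hs hd2 hg hMg).mono_set hDd
  have iN := integrableOn_mul_fracKernel hn hs hd hN hMN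
  have iB := integrableOn_mul_fracKernel hn hs hd2 hB hMB
  rw [← integrable_indicator_iff (measurableSet_le_norm _)] at iN iB
  rw [← integrable_indicator_iff hD] at ig
  rw [← integral_indicator hD, ← integral_indicator (measurableSet_le_norm _),
    ← integral_indicator (measurableSet_le_norm _), ← integral_const_mul,
    ← integral_add_right_eq_self (fun v => 2 ^ q * {v : En n | d ≤ ‖v‖}.indicator
      (fun v => N v * fracKernel n s v) v) a,
    ← integral_sub ig ((iN.comp_add_right a).const_mul _)]
  refine integral_mono (ig.sub ((iN.comp_add_right a).const_mul _)) iB fun z => ?_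
  have hk := fracKernel_nonneg n s z
  have hk' := fracKernel_nonneg n s (z + a)
  have hind0 : 0 ≤ {v : En n | d ≤ ‖v‖}.indicator (fun v => N v * fracKernel n s v) (z + a) :=
    indicator_nonneg (fun v _ => mul_nonneg (hNn v) (fracKernel_nonneg n s v)) _
  have h2q : (0 : ℝ) < 2 ^ q := by positivity
  simp only
  by_cases hzD : z ∈ D
  · rw [indicator_of_mem hzD, indicator_of_mem (hDd hzD)]
    have := mul_le_mul_of_nonneg_right (hBD z hzD) hk
    nlinarith
  rw [indicator_of_notMem hzD]
  by_cases hz : ‖z + a‖ ≤ d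
  · have : 0 ≤ {z : En n | d / 2 ≤ ‖z‖}.indicator (fun z => B z * fracKernel n s z) z := by
      rw [indicator_apply]
      split_ifs
      · exact mul_nonneg (hBn z hz) hk
      · exact le_rfl
    nlinarith
  · push Not at hz
    have hza : ‖z + a‖ ≤ ‖z‖ + ‖a‖ := norm_add_le z a
    have hzd : d / 2 ≤ ‖z‖ := by linarith
    rw [indicator_of_mem (show z + a ∈ {v : En n | d ≤ ‖v‖} from hz.le),
      indicator_of_mem (show z ∈ {v : En n | d / 2 ≤ ‖v‖} from hzd)]
    have hcomp : fracKernel n s z ≤ 2 ^ q * fracKernel n s (z + a) := by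
      unfold fracKernel
      rw [← hq, ← div_eq_mul_inv, inv_eq_one_div, div_le_div_iff₀
        (Real.rpow_pos_of_pos (by linarith) q) (Real.rpow_pos_of_pos (by linarith) q), one_mul,
        ← Real.mul_rpow (by norm_num) (norm_nonneg z)]
      exact Real.rpow_le_rpow (norm_nonneg _) (by linarith) hq0.le
    have h1 := mul_le_mul_of_nonneg_right (hBN z) hk
    have h2 := mul_le_mul_of_nonneg_left hcomp (hNn (z + a))
    nlinarith

lemma exists_max_sub_cut {n : ℕ} {Z : En n → ℝ → ℝ} (hZ : Continuous fun p : En n × ℝ => Z p.1 p.2)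
    {κ A R T : ℝ} (hA : 0 ≤ A) (hR : 0 < R) (hT : 0 < T) {x₀ : En n} {t₀ : ℝ}
    (hle : ∀ x t, Z x t ≤ κ + A) (h₀ : κ < Z x₀ t₀) :
    ∃ x₁ ∈ Metric.closedBall x₀ R, ∃ t₁ ∈ Icc (t₀ - T) (t₀ + T),
      κ < Z x₁ t₁ - spaceCut x₀ R A x₁ - timeCut t₀ T A t₁ ∧
      ∀ x t, Z x t - spaceCut x₀ R A x - timeCut t₀ T A t ≤
        Z x₁ t₁ - spaceCut x₀ R A x₁ - timeCut t₀ T A t₁ := by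
  have hcont : Continuous fun p : En n × ℝ =>
      Z p.1 p.2 - spaceCut x₀ R A p.1 - timeCut t₀ T A p.2 :=
    (hZ.sub ((continuous_spaceCut x₀ R A).comp continuous_fst)).sub
      ((continuous_timeCut t₀ T A).comp continuous_snd)
  have hmem : (x₀, t₀) ∈ Metric.closedBall x₀ R ×ˢ Icc (t₀ - T) (t₀ + T) :=
    ⟨Metric.mem_closedBall_self hR.le, by constructor <;> linarith⟩
  obtain ⟨⟨x₁, t₁⟩, ⟨hx₁, ht₁⟩, hmax⟩ := ((isCompact_closedBall x₀ R).prod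
    (isCompact_Icc (a := t₀ - T) (b := t₀ + T))).exists_isMaxOn ⟨_, hmem⟩ hcont.continuousOn
  have hκ : κ < Z x₁ t₁ - spaceCut x₀ R A x₁ - timeCut t₀ T A t₁ := by
    have := hmax hmem
    simp only [mem_ofPred_eq, spaceCut_self, timeCut_self] at this
    linarith
  refine ⟨x₁, hx₁, t₁, ht₁, hκ, fun x t => ?_⟩
  have h1 := hle x t
  have h2 := spaceCut_nonneg x₀ R hA x
  have h3 := timeCut_nonneg t₀ hT hA t
  by_cases hx : x ∈ Metric.closedBall x₀ R
  · by_cases ht : t ∈ Icc (t₀ - T) (t₀ + T)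
    · exact hmax (⟨hx, ht⟩ : (x, t) ∈ Metric.closedBall x₀ R ×ˢ Icc (t₀ - T) (t₀ + T))
    · rw [timeCut_of_notMem hT A ht]; linarith
  · rw [spaceCut_of_notMem hR A hx]; linarith

lemma exists_max_perturbed {n : ℕ} {Z Z' : En n → ℝ → ℝ} {κ A R T η d δ : ℝ} (hA : 0 ≤ A)
    (hT : 0 < T) (hd : 0 < d) (hd1 : d ≤ 1) (hη : 0 < η) {x₀ x₁ : En n} {t₀ t₁ : ℝ}
    (ht₁ : t₁ ∈ Icc (t₀ - T) (t₀ + T))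
    (hmax : ∀ x t, Z x t - spaceCut x₀ R A x - timeCut t₀ T A t ≤
        Z x₁ t₁ - spaceCut x₀ R A x₁ - timeCut t₀ T A t₁)
    (hc : ContinuousOn (fun p : En n × ℝ => Z' p.1 p.2)
      (Metric.closedBall x₁ d ×ˢ Icc (t₀ - T) (t₀ + T)))
    (hle : ∀ x t, Z' x t ≤ κ + A)
    (hclose : ∀ x ∈ Metric.closedBall x₁ d, ∀ t ∈ Icc (t₀ - T) (t₀ + T), |Z' x t - Z x t| ≤ δ)
    (hδκ : κ + δ < Z x₁ t₁ - spaceCut x₀ R A x₁ - timeCut t₀ T A t₁)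
    (hδη : 2 * δ < η * (d / 2) ^ 2) :
    ∃ x₂ : En n, ∃ t₂ ∈ Icc (t₀ - T) (t₀ + T), ∃ S : ℝ,
      S = Z' x₂ t₂ - (spaceCut x₀ R A x₂ + spaceCut x₁ 1 η x₂) - timeCut t₀ T A t₂ ∧
      ‖x₂ - x₁‖ < d / 2 ∧ κ < S ∧
      Z' x₁ t₁ - spaceCut x₀ R A x₁ - timeCut t₀ T A t₁ ≤ S ∧
      (∀ x ∈ Metric.closedBall x₁ d,
        Z' x t₂ - (spaceCut x₀ R A x + spaceCut x₁ 1 η x) - timeCut t₀ T A t₂ ≤ S) ∧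
      ∀ t, Z' x₂ t - (spaceCut x₀ R A x₂ + spaceCut x₁ 1 η x₂) - timeCut t₀ T A t ≤ S := by
  have hcont : ContinuousOn (fun p : En n × ℝ => Z' p.1 p.2 -
      (spaceCut x₀ R A p.1 + spaceCut x₁ 1 η p.1) - timeCut t₀ T A p.2)
      (Metric.closedBall x₁ d ×ˢ Icc (t₀ - T) (t₀ + T)) :=
    (hc.sub ((((continuous_spaceCut x₀ R A).comp continuous_fst).add
      ((continuous_spaceCut x₁ 1 η).comp continuous_fst)).continuousOn)).sub
      ((continuous_timeCut t₀ T A).comp continuous_snd).continuousOn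
  have hself : x₁ ∈ Metric.closedBall x₁ d := Metric.mem_closedBall_self hd.le
  have hmem : (x₁, t₁) ∈ Metric.closedBall x₁ d ×ˢ Icc (t₀ - T) (t₀ + T) := ⟨hself, ht₁⟩
  obtain ⟨⟨x₂, t₂⟩, ⟨hx₂, ht₂⟩, hmax'⟩ := ((isCompact_closedBall x₁ d).prod
    (isCompact_Icc (a := t₀ - T) (b := t₀ + T))).exists_isMaxOn ⟨_, hmem⟩ hcont
  have h1 := hmax' hmem
  simp only [mem_ofPred_eq, spaceCut_self, add_zero] at h1
  have e1 := abs_le.1 (hclose x₁ hself t₁ ht₁)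
  have e2 := abs_le.1 (hclose x₂ hx₂ t₂ ht₂)
  have e3 := hmax x₂ t₂
  refine ⟨x₂, t₂, ht₂, _, rfl, ?_, by linarith, h1, fun x hx => ?_, fun t => ?_⟩
  · by_contra! hfar
    have : η * (d / 2) ^ 2 ≤ spaceCut x₁ 1 η x₂ := by
      unfold spaceCut
      gcongr
      rw [one_pow, div_one, le_min_iff]
      constructor
      · gcongr
      · nlinarith
    linarith
  · exact hmax' (⟨hx, ht₂⟩ : (x, t₂) ∈ Metric.closedBall x₁ d ×ˢ Icc (t₀ - T) (t₀ + T))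
  · by_cases ht : t ∈ Icc (t₀ - T) (t₀ + T)
    · exact hmax' (⟨hx₂, ht⟩ : (x₂, t) ∈ Metric.closedBall x₁ d ×ˢ Icc (t₀ - T) (t₀ + T))
    · rw [timeCut_of_notMem hT A ht]
      have := hle x₂ t
      have h2 := spaceCut_nonneg x₀ R hA x₂
      have h3 := spaceCut_nonneg x₁ 1 hη.le x₂
      linarith

lemma opQuot_limit_ge_at_max {α : ℝ} (hα : 0 < α) (hα1 : α ≤ 1) {n : ℕ} (hn : 1 ≤ n) {s : ℝ}
    (hs : s ∈ Ioo (0 : ℝ) 1) {Cns : ℝ} (hC : 0 ≤ Cns) {w : En n → ℝ → ℝ} (hw : SepContBdd w)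
    {c A F R T η θ d S : ℝ} {m : ℕ} (hm : 0 < m) (hA : 0 ≤ A) (hF : 0 ≤ F) (hR : 0 < R)
    (hT : 0 < T) (hη : 0 ≤ η) (hd : 0 < d) {x₀ x₁ x : En n} {t₀ t : ℝ}
    (hS : S = backSum θ m (fun r => max (w x r - c) 0) t -
      (spaceCut x₀ R A x + spaceCut x₁ 1 η x) - timeCut t₀ T A t)
    (hspace : ∀ z, ‖z‖ ≤ d → backSum θ m (fun r => max (w (x + z) r - c) 0) t -
      (spaceCut x₀ R A (x + z) + spaceCut x₁ 1 η (x + z)) - timeCut t₀ T A t ≤ S)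
    (htime : ∀ τ, backSum θ m (fun r => max (w x r - c) 0) τ -
      (spaceCut x₀ R A x + spaceCut x₁ 1 η x) - timeCut t₀ T A τ ≤ S)
    (hlim : ∀ i < m, c < w x (t - θ * i / m) → ∃ f ≤ F, Tendsto
      (fun ε => opQuot α n s Cns ε w x (t - θ * i / m)) (nhdsWithin 0 (Ioi 0)) (nhds f)) :
    Cns * (∫ z in {z : En n | d ≤ ‖z‖}, (S - (backSum θ m (fun r => max (w (x + z) r - c) 0) t -
      (spaceCut x₀ R A (x + z) + spaceCut x₁ 1 η (x + z)) - timeCut t₀ T A t)) *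
        fracKernel n s z) ≤
      F + (A * cutoffCost α n s Cns R T + η * (Cns * fracMass n s + 2 * n)) := by
  classical
  have hm' : (0 : ℝ) < m := by exact_mod_cast hm
  have hY := hw.posPart c
  have hZ := hY.backSum θ m
  obtain ⟨MZ, hMZ⟩ := hZ.bdd
  set J := (Finset.range m).filter fun i : ℕ => c < w x (t - θ * i / m) with hJ
  set W : En n → ℝ → ℝ := fun y τ => (m : ℝ)⁻¹ * ∑ i ∈ J, (w y (τ - θ * (i : ℕ) / m) - c) with hW
  have hWs : SepContBdd W :=
    (hw.sub_const c).const_mul_sum (m : ℝ)⁻¹ J fun i : ℕ => θ * i / m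
  have hWle : ∀ y τ, W y τ ≤ backSum θ m (fun r => max (w y r - c) 0) τ := by
    intro y τ
    simp only [hW, backSum]
    gcongr
    exact (Finset.sum_le_sum fun i _ => le_max_left _ 0).trans
      (Finset.sum_le_sum_of_subset_of_nonneg (Finset.filter_subset _ _)
        fun i _ _ => le_max_right _ _)
  have hWeq : W x t = backSum θ m (fun r => max (w x r - c) 0) t := by
    simp only [hW, backSum]
    congr 1
    rw [hJ, Finset.sum_filter]
    refine Finset.sum_congr rfl fun i _ => ?_
    split_ifs with h
    · rw [max_eq_left (by linarith)]
    · rw [max_eq_right (by linarith)]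
  set P : En n → ℝ := fun z => (spaceCut x₀ R A x + spaceCut x₁ 1 η x) -
    (spaceCut x₀ R A (x + z) + spaceCut x₁ 1 η (x + z)) with hP
  set B : En n → ℝ := fun z => S - (backSum θ m (fun r => max (w (x + z) r - c) 0) t -
      (spaceCut x₀ R A (x + z) + spaceCut x₁ 1 η (x + z)) - timeCut t₀ T A t) with hB
  have hcs := continuous_spaceCut x₀ R A
  have hcs' := continuous_spaceCut x₁ 1 η
  have hcZ := hZ.cont_space t
  have hshift : Continuous fun z => x + z := by fun_prop
  have hPm : Measurable P := by
    refine Continuous.measurable (continuous_const.sub ?_)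
    exact (hcs.comp hshift).add (hcs'.comp hshift)
  have hBm : Measurable B := by
    refine Continuous.measurable (continuous_const.sub (((hcZ.comp hshift).sub ?_).sub
      continuous_const))
    exact (hcs.comp hshift).add (hcs'.comp hshift)
  have b1 := fun y => spaceCut_nonneg x₀ R hA y
  have b2 := fun y => spaceCut_le x₀ R hA y
  have b3 := fun y => spaceCut_nonneg x₁ 1 hη y
  have b4 := fun y => spaceCut_le x₁ 1 hη y
  have hPb : ∀ z, |P z| ≤ A + η := fun z => by
    rw [abs_le]
    constructor <;> simp only [hP] <;> linarith [b1 x, b2 x, b3 x, b4 x, b1 (x + z), b2 (x + z),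
      b3 (x + z), b4 (x + z)]
  have hBb : ∀ z, |B z| ≤ |S| + MZ + A + η + |timeCut t₀ T A t| := fun z => by
    have h1 := abs_le.1 (hMZ (x + z) t)
    have h2 := abs_le.1 (le_refl |S|)
    have h3 := abs_le.1 (le_refl |timeCut t₀ T A t|)
    rw [abs_le]
    constructor <;> simp only [hB] <;> linarith [b1 (x + z), b2 (x + z),
      b3 (x + z), b4 (x + z)]
  have hbound : ∀ ε ∈ Ioc 0 d, Cns * (∫ z in {z : En n | d ≤ ‖z‖}, B z * fracKernel n s z) -
      (A * cutoffCost α n s Cns R T + η * (Cns * fracMass n s + 2 * n)) ≤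
      (m : ℝ)⁻¹ * ∑ i ∈ J, opQuot α n s Cns ε w x (t - θ * i / m) := by
    intro ε hε
    rw [← opQuot_const_mul_sum hα hn hs Cns hε.1 hw (m : ℝ)⁻¹ c J (fun i : ℕ => θ * i / m) x t]
    refine opQuot_ge hα hα1 hn hs hC hε.1 hε.2 hWs hPm hPb hBm hBb (fun z hz => ?_) hA hR hT hη
      (fun z => ?_) (fun z => ?_) fun ρ hρ => ?_
    · simp only [hB]
      linarith [hspace z hz]
    · have h1 := spaceCut_second_difference x₀ hR hA x z
      have h2 := spaceCut_second_difference x₁ one_pos hη x z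
      rw [one_pow, div_one] at h2
      simp only [hP]
      linarith
    · have h1 := hWle (x + z) t
      simp only [hB, hP]
      linarith
    · have h1 := hWle x (t - ρ)
      have h2 := timeCut_sub_ge t₀ hT hA t hρ
      have h3 := htime (t - ρ)
      linarith
  have hlim' : ∀ i : ℕ, i ∈ J → ∃ f, f ≤ F ∧ Tendsto
      (fun ε => opQuot α n s Cns ε w x (t - θ * i / m)) (nhdsWithin 0 (Ioi 0)) (nhds f) := by
    intro i hi
    rw [hJ, Finset.mem_filter, Finset.mem_range] at hi
    exact hlim i hi.1 hi.2
  choose! f hfF hf using hlim'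
  have htend := (tendsto_finsetSum J hf).const_mul (m : ℝ)⁻¹
  have h1 := ge_of_tendsto htend (by
    filter_upwards [Ioc_mem_nhdsGT hd] with ε hε
    exact hbound ε hε)
  have h2 : (m : ℝ)⁻¹ * ∑ i ∈ J, f i ≤ F := by
    rw [inv_mul_le_iff₀ hm']
    refine (Finset.sum_le_card_nsmul _ _ F hfF).trans ?_
    rw [nsmul_eq_mul]
    gcongr
    exact (Finset.card_filter_le _ _).trans (by simp)
  linarith

lemma tendsto_integral_mul_fracKernel_zero {n : ℕ} (hn : 1 ≤ n) {s : ℝ} (hs : s ∈ Ioo (0 : ℝ) 1)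
    {d : ℝ} (hd : 0 < d) {N : ℕ → En n → ℝ} (hN : ∀ m, Measurable (N m)) {M : ℝ}
    (hM : ∀ᶠ m in atTop, ∀ v, |N m v| ≤ M) (hlim : ∀ v, Tendsto (fun m => N m v) atTop (nhds 0)) :
    Tendsto (fun m => ∫ v in {v : En n | d ≤ ‖v‖}, N m v * fracKernel n s v) atTop (nhds 0) := by
  have := tendsto_integral_filter_of_dominated_convergence
    (μ := volume.restrict {v : En n | d ≤ ‖v‖}) (l := atTop)
    (F := fun m v => N m v * fracKernel n s v) (f := fun _ => 0)
    (fun v => M * fracKernel n s v)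
    (Eventually.of_forall fun m => ((hN m).mul (measurable_fracKernel n s)).aestronglyMeasurable)
    (hM.mono fun m hm => Eventually.of_forall fun v => ?_)
    ((integrableOn_fracKernel hn hs hd).const_mul M)
    (Eventually.of_forall fun v => ?_)
  · simpa using this
  · rw [Real.norm_eq_abs, abs_mul, abs_of_nonneg (fracKernel_nonneg n s v)]
    gcongr
    · exact fracKernel_nonneg n s v
    · exact hm v
  · simpa using (hlim v).mul_const (fracKernel n s v)

/-- A maximum principle for the truncated operator. The function `w` need only be jointly
continuous where it may exceed the level `c`. -/
theorem exists_penalized_bound {α : ℝ} (hα : 0 < α) (hα1 : α ≤ 1) {n : ℕ} (hn : 1 ≤ n) {s : ℝ}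
    (hs : s ∈ Ioo (0 : ℝ) 1) {Cns : ℝ} (hC : 0 ≤ Cns) {w : En n → ℝ → ℝ} (hw : SepContBdd w)
    {c κ A F R T : ℝ} (hA : 0 ≤ A) (hκ : 0 < κ) (hF : 0 ≤ F) (hR : 0 < R) (hT : 0 < T)
    {x₀ : En n} {t₀ : ℝ} (hle : ∀ x t, w x t - c ≤ κ + A) (h₀ : κ < w x₀ t₀ - c)
    {V : Set (En n)} (hV : IsOpen V)
    (hoff : ∀ x ∈ Metric.closedBall x₀ R, x ∉ V → ∀ t ∈ Icc (t₀ - 2 * T) (t₀ + T), w x t ≤ c)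
    (hcont : ContinuousOn (fun p : En n × ℝ => w p.1 p.2) (V ×ˢ Icc (t₀ - 2 * T) (t₀ + T)))
    (hop : ∀ x ∈ V, x ∈ Metric.closedBall x₀ R → ∀ t ∈ Icc (t₀ - 2 * T) (t₀ + T), c < w x t →
      ∃ f ≤ F, Tendsto (fun ε => opQuot α n s Cns ε w x t) (nhdsWithin 0 (Ioi 0)) (nhds f))
    {ε l : ℝ} (hε : 0 < ε) (hl : 0 < l) {D : Set (En n)} (hD : MeasurableSet D)
    (hDl : D ⊆ {z | l ≤ ‖z‖}) :
    ∃ x ∈ Metric.closedBall x₀ R, ∃ m : ℕ, 0 < m ∧ ∃ t : ℕ → ℝ,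
      (∀ i < m, t i ∈ Icc (t₀ - 2 * T) (t₀ + T)) ∧
      Cns * (∫ z in D, (κ - (m : ℝ)⁻¹ * ∑ i ∈ Finset.range m, max (w (x + z) (t i) - c) 0) *
        fracKernel n s z) ≤ F + A * cutoffCost α n s Cns R T + ε := by
  have hY := hw.posPart c
  obtain ⟨κ', hκ', hκw⟩ := exists_between h₀
  obtain ⟨θ, hθ, hθT, hθw⟩ : ∃ θ, 0 < θ ∧ θ ≤ T ∧ ∀ r ∈ Icc (t₀ - θ) t₀, κ' ≤ w x₀ r - c := by
    have h1 : ∀ᶠ r in nhds t₀, κ' < w x₀ r - c :=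
      ((hw.sub_const c).cont_time x₀).continuousAt.eventually (lt_mem_nhds hκw)
    obtain ⟨γ, hγ, h2⟩ := Metric.eventually_nhds_iff.1 h1
    refine ⟨min (γ / 2) T, by positivity, min_le_right _ _, fun r hr => (h2 ?_).le⟩
    have := min_le_left (γ / 2) T
    rw [Real.dist_eq, abs_lt]
    constructor <;> linarith [hr.1, hr.2]
  set Y : En n → ℝ → ℝ := fun x t => max (w x t - c) 0 with hYdef
  have hYle : ∀ x t, Y x t ≤ κ + A := fun x t => max_le (hle x t) (by linarith)
  have hYnn : ∀ x t, 0 ≤ Y x t := fun x t => le_max_right _ _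
  have hZc := continuous_backAvg hY hθ
  have hZ₀ : κ < backAvg θ (Y x₀) t₀ := hκ'.trans_le <|
    backAvg_ge hθ (hY.cont_time x₀) fun r hr => (hθw r hr).trans (le_max_left _ _)
  obtain ⟨x₁, hx₁, t₁, ht₁, hκ₁, hmax⟩ := exists_max_sub_cut (Z := fun x t => backAvg θ (Y x) t)
    hZc hA hR hT (fun x t => backAvg_le hθ (hY.cont_time x) (hYle x)) hZ₀
  have hx₁V : x₁ ∈ V := by
    by_contra hx
    have : backAvg θ (Y x₁) t₁ ≤ 0 := by
      have h1 : backAvg θ (Y x₁) t₁ = 0 := by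
        unfold backAvg
        rw [intervalIntegral.integral_congr (g := fun _ => (0 : ℝ))]
        · simp
        · intro r hr
          rw [uIcc_of_le (by linarith)] at hr
          refine max_eq_right ?_
          have := hoff x₁ hx₁ hx r ⟨by linarith [hr.1, ht₁.1], hr.2.trans ht₁.2⟩
          linarith
      exact h1.le
    have h2 := spaceCut_nonneg x₀ R hA x₁
    have h3 := timeCut_nonneg t₀ hT hA t₁
    linarith
  obtain ⟨d', hd', hd'V⟩ := Metric.nhds_basis_closedBall.mem_iff.1 (hV.mem_nhds hx₁V)
  obtain ⟨d, hd, hdd, hd1, hdl⟩ : ∃ d, 0 < d ∧ d ≤ d' ∧ d ≤ 1 ∧ d ≤ l :=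
    ⟨min d' (min 1 l), by positivity, min_le_left _ _,
      (min_le_right _ _).trans (min_le_left _ _), (min_le_right _ _).trans (min_le_right _ _)⟩
  have hdV : Metric.closedBall x₁ d ⊆ V := (Metric.closedBall_subset_closedBall hdd).trans hd'V
  have hE : 0 ≤ Cns * fracMass n s + 2 * n := by
    have := fracMass_nonneg n s; positivity
  obtain ⟨η, hη, hηε⟩ : ∃ η, 0 < η ∧ η * (Cns * fracMass n s + 2 * n) ≤ ε / 2 := by
    refine ⟨ε / 2 / (Cns * fracMass n s + 2 * n + 1), by positivity, ?_⟩
    rw [div_mul_eq_mul_div, div_le_iff₀ (by positivity)]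
    nlinarith
  obtain ⟨δ, hδ, hδκ, hδη⟩ : ∃ δ, 0 < δ ∧
      κ + δ < backAvg θ (Y x₁) t₁ - spaceCut x₀ R A x₁ - timeCut t₀ T A t₁ ∧
      2 * δ < η * (d / 2) ^ 2 := by
    obtain ⟨δ, hδ, h1⟩ := exists_between (lt_min (sub_pos.2 hκ₁)
      (show 0 < η * (d / 2) ^ 2 / 2 by positivity))
    rw [lt_min_iff] at h1
    exact ⟨δ, hδ, by linarith, by linarith⟩
  have hYcont : ContinuousOn (fun p : En n × ℝ => Y p.1 p.2)
      (V ×ˢ Icc (t₀ - 2 * T) (t₀ + T)) := (by fun_prop : Continuous fun r : ℝ => max (r - c) 0).comp_continuousOn hcont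
  have hwin : Icc (t₀ - T - θ) (t₀ + T) ⊆ Icc (t₀ - 2 * T) (t₀ + T) :=
    Icc_subset_Icc_left (by linarith)
  have hev := eventually_abs_backSum_sub_backAvg_le hY.cont_time (a := t₀ - T) (b := t₀ + T) hθ
    (isCompact_closedBall x₁ d) (hYcont.mono (prod_mono hdV hwin)) hδ
  have hstep : ∀ m : ℕ, 0 < m → ∀ i < m, ∀ t ∈ Icc (t₀ - T) (t₀ + T),
      t - θ * i / m ∈ Icc (t₀ - 2 * T) (t₀ + T) := by
    intro m hm i hi t ht
    have := mul_div_mem_Ico hθ hi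
    exact ⟨by linarith [this.2, ht.1], by linarith [this.1, ht.2]⟩
  have hpert := (hev.and (eventually_gt_atTop 0)).mono fun m hm =>
    exists_max_perturbed (Z := fun x t => backAvg θ (Y x) t)
      (Z' := fun x t => backSum θ m (Y x) t) hA hT hd hd1 hη ht₁ hmax
      (continuousOn_const.mul (continuousOn_finsetSum _ fun i hi =>
        hYcont.comp (f := fun p : En n × ℝ => (p.1, p.2 - θ * i / m)) (by fun_prop) fun p hp =>
          ⟨hdV hp.1, hstep m hm.2 i (Finset.mem_range.1 hi) p.2 hp.2⟩))
      (fun x t => backSum_le hm.2 (hYle x)) hm.1 hδκ hδη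
  obtain ⟨X, hX⟩ := hpert.choice
  obtain ⟨τ, hτ⟩ := hX.choice
  set N : ℕ → En n → ℝ := fun m v =>
    |backSum θ m (Y (x₁ + v)) (τ m) - backAvg θ (Y (x₁ + v)) (τ m)| +
      |backSum θ m (Y x₁) t₁ - backAvg θ (Y x₁) t₁| with hNdef
  have hshift : Continuous fun v : En n => x₁ + v := by fun_prop
  have hNm : ∀ m, Measurable (N m) := fun m => by
    refine Continuous.measurable (((Continuous.sub ?_ ?_).abs).add continuous_const)
    · exact ((hY.backSum θ m).cont_space (τ m)).comp hshift
    · exact hZc.comp (f := fun v : En n => (x₁ + v, τ m)) (by fun_prop)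
  have hdiff : ∀ m : ℕ, 0 < m → ∀ y t,
      |backSum θ m (Y y) t - backAvg θ (Y y) t| ≤ κ + A := by
    intro m hm y t
    have a1 := backSum_le (θ := θ) hm (t := t) (hYle y)
    have a2 := backSum_nonneg (θ := θ) (m := m) (t := t) (hYnn y)
    have a3 := backAvg_le hθ (hY.cont_time y) (t := t) (hYle y)
    have a4 := backAvg_ge hθ (hY.cont_time y) (t := t) (fun r _ => hYnn y r)
    rw [abs_le]
    constructor <;> linarith
  have hNb : ∀ m : ℕ, 0 < m → ∀ v, |N m v| ≤ 2 * (κ + A) := fun m hm v => by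
    rw [abs_of_nonneg (by positivity)]
    have := hdiff m hm (x₁ + v) (τ m)
    have := hdiff m hm x₁ t₁
    simp only [hNdef]
    linarith
  have hNlim : ∀ v, Tendsto (fun m => N m v) atTop (nhds 0) := fun v => by
    have h1 := tendsto_backSum (hY.cont_time (x₁ + v)) hθ (hτ.mono fun m hm => hm.1)
    have h2 := tendsto_backSum (hY.cont_time x₁) hθ
      (t := fun _ => t₁) (Eventually.of_forall fun _ => ht₁)
    simpa using h1.add h2
  have hIlim := (tendsto_integral_mul_fracKernel_zero hn hs hd hNm
    ((eventually_gt_atTop 0).mono hNb) hNlim).const_mul (Cns * 2 ^ ((n : ℝ) + 2 * s))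
  rw [mul_zero] at hIlim
  obtain ⟨m, ⟨hm, hIm⟩, htm, S, hS, hXm, hSκ, hS₁, hball, htime⟩ :=
    (((eventually_gt_atTop 0).and (hIlim.eventually (gt_mem_nhds (half_pos hε)))).and hτ).exists
  have hZ' := hY.backSum θ m
  obtain ⟨MZ, hMZ⟩ := hZ'.bdd
  have b1 := fun y => spaceCut_nonneg x₀ R hA y
  have b2 := fun y => spaceCut_le x₀ R hA y
  have b3 := fun y => spaceCut_nonneg x₁ 1 hη.le y
  have b4 := fun y => spaceCut_le x₁ 1 hη.le y
  have b5 := timeCut_nonneg t₀ hT hA (τ m)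
  have hXball : X m ∈ Metric.closedBall x₀ R := by
    by_contra hx
    have h1 := spaceCut_of_notMem hR A hx
    have h2 := backSum_le (θ := θ) hm (t := τ m) (hYle (X m))
    linarith [b3 (X m)]
  have hXd : X m ∈ Metric.closedBall x₁ d := by
    rw [Metric.mem_closedBall, dist_eq_norm]; linarith
  have hmain := opQuot_limit_ge_at_max hα hα1 hn hs hC hw hm hA hF hR hT hη.le
    (half_pos hd) hS (fun z hz => hball _ (by
      rw [Metric.mem_closedBall, dist_eq_norm, add_sub_right_comm]
      linarith [norm_add_le (X m - x₁) z])) htime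
    (fun i hi hc => hop _ (hdV hXd) hXball _ (hstep m hm i hi _ htm) hc)
  have htail := integral_mul_fracKernel_tail_ge hn hs hd (a := X m - x₁) hXm.le hD
    (fun z hz => by
      have : l ≤ ‖z‖ := hDl hz
      change d / 2 ≤ ‖z‖
      linarith)
    (B := fun z => S - (backSum θ m (Y (X m + z)) (τ m) -
      (spaceCut x₀ R A (X m + z) + spaceCut x₁ 1 η (X m + z)) - timeCut t₀ T A (τ m)))
    (g := fun z => κ - backSum θ m (Y (X m + z)) (τ m)) (N := N m)
    (MB := |S| + MZ + A + η + |timeCut t₀ T A (τ m)|) (Mg := |κ| + MZ)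
    (Continuous.measurable (by
      have h1 : Continuous fun z : En n => X m + z := by fun_prop
      exact continuous_const.sub ((((hZ'.cont_space (τ m)).comp h1).sub
        (((continuous_spaceCut x₀ R A).comp h1).add
          ((continuous_spaceCut x₁ 1 η).comp h1))).sub continuous_const)))
    (fun z => by
      have h1 := abs_le.1 (hMZ (X m + z) (τ m))
      have h2 := abs_le.1 (le_refl |S|)
      have h3 := abs_le.1 (le_refl |timeCut t₀ T A (τ m)|)
      rw [abs_le]
      constructor <;> linarith [b1 (X m + z), b2 (X m + z), b3 (X m + z), b4 (X m + z)])
    (Continuous.measurable (continuous_const.sub ((hZ'.cont_space (τ m)).comp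
      (by fun_prop : Continuous fun z : En n => X m + z))))
    (fun z => (abs_sub _ _).trans (by gcongr; exact hMZ _ _))
    (hNm m) (hNb m hm) (fun v => by positivity)
    (fun z _ => by linarith [b1 (X m + z), b3 (X m + z)])
    (fun z hz => sub_nonneg.2 (hball _ (by
      rw [Metric.mem_closedBall, dist_eq_norm, add_sub_right_comm, add_comm]; exact hz)))
    (fun z => by
      have e0 : x₁ + (z + (X m - x₁)) = X m + z := by abel
      have e1 := neg_abs_le (backSum θ m (Y x₁) t₁ - backAvg θ (Y x₁) t₁)
      have e2 := le_abs_self (backSum θ m (Y (X m + z)) (τ m) - backAvg θ (Y (X m + z)) (τ m))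
      have e3 := hmax (X m + z) (τ m)
      simp only [hNdef, e0]
      linarith [b3 (X m + z)])
  refine ⟨X m, hXball, m, hm, fun i => τ m - θ * i / m, fun i hi => hstep m hm i hi _ htm, ?_⟩
  have hfin := mul_le_mul_of_nonneg_left htail hC
  have hexp : Cns * 2 ^ ((n : ℝ) + 2 * s) *
      (∫ v in {v : En n | d ≤ ‖v‖}, N m v * fracKernel n s v) < ε / 2 := hIm
  change Cns * (∫ z in D, (κ - backSum θ m (Y (X m + z)) (τ m)) * fracKernel n s z) ≤ _
  have hmain' := hmain
  rw [mul_sub] at hfin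
  simp only [hYdef] at *
  linarith

/-- The ball of radius `ρ` centred at `-3ρ eᵢ`. -/
def lowerBall {n : ℕ} (i : Fin n) (ρ : ℝ) : Set (En n) := Metric.ball (-(3 * ρ) • eDir i) ρ

lemma norm_of_mem_lowerBall {n : ℕ} {i : Fin n} {ρ : ℝ} (hρ : 0 < ρ) {z : En n}
    (hz : z ∈ lowerBall i ρ) : 2 * ρ ≤ ‖z‖ ∧ ‖z‖ ≤ 4 * ρ := by
  have h1 : ‖z - -(3 * ρ) • eDir i‖ < ρ := mem_ball_iff_norm.1 hz
  have h2 : ‖(-(3 * ρ) • eDir i : En n)‖ = 3 * ρ := by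
    simp [eDir, norm_smul, abs_of_pos hρ]
  have h3 := norm_sub_norm_le z (-(3 * ρ) • eDir i)
  have h4 := norm_sub_norm_le (-(3 * ρ) • eDir i) z
  rw [norm_sub_rev] at h4
  constructor <;> linarith

lemma apply_le_of_mem_lowerBall {n : ℕ} {i : Fin n} {ρ : ℝ} {z : En n}
    (hz : z ∈ lowerBall i ρ) : z i ≤ -(2 * ρ) := by
  have h1 : ‖z - -(3 * ρ) • eDir i‖ < ρ := mem_ball_iff_norm.1 hz
  have h2 := PiLp.norm_apply_le (z - -(3 * ρ) • eDir i) i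
  have h3 : (z - -(3 * ρ) • eDir i) i = z i + 3 * ρ := by simp [eDir]
  rw [h3, Real.norm_eq_abs] at h2
  linarith [le_abs_self (z i + 3 * ρ)]

lemma exists_le_integral_lowerBall {n : ℕ} (hn : 1 ≤ n) {s : ℝ} (hs : s ∈ Ioo (0 : ℝ) 1)
    (i : Fin n) :
    ∃ b : ℝ, 0 < b ∧ ∀ ρ, 0 < ρ → b * (ρ ^ (2 * s))⁻¹ ≤ ∫ z in lowerBall i ρ, fracKernel n s z := by
  have hv : 0 < volume.real (Metric.ball (0 : En n) 1) :=
    ENNReal.toReal_pos (Metric.measure_ball_pos _ _ one_pos).ne' measure_ball_lt_top.ne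
  refine ⟨volume.real (Metric.ball (0 : En n) 1) * ((4 : ℝ) ^ ((n : ℝ) + 2 * s))⁻¹,
    by positivity, fun ρ hρ => ?_⟩
  have h1 : volume.real (lowerBall i ρ) * ((4 * ρ) ^ ((n : ℝ) + 2 * s))⁻¹ ≤
      ∫ z in lowerBall i ρ, fracKernel n s z := by
    rw [← smul_eq_mul, ← setIntegral_const]
    refine setIntegral_mono_on (integrableOn_const measure_ball_lt_top.ne)
      ((integrableOn_fracKernel hn hs (show 0 < 2 * ρ by positivity)).mono_set
        fun z hz => (norm_of_mem_lowerBall hρ hz).1) measurableSet_ball fun z hz => ?_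
    have h2 := norm_of_mem_lowerBall hρ hz
    have h3 : 0 < ‖z‖ := by linarith [h2.1]
    have h4 : (0 : ℝ) ≤ (n : ℝ) + 2 * s := by have := hs.1; positivity
    unfold fracKernel
    gcongr
    exact h2.2
  refine le_of_eq_of_le ?_ h1
  unfold lowerBall
  simp only [measureReal_def]
  rw [Measure.addHaar_ball_of_pos _ _ hρ, finrank_euclideanSpace_fin,
    ENNReal.toReal_mul, ENNReal.toReal_ofReal (by positivity), Real.mul_rpow (by norm_num) hρ.le,
    Real.rpow_add hρ, Real.rpow_natCast]
  field_simp

/-- Bounded, separately continuous entire solutions of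
`∂ₜᵅ u + (-Δ)ˢ u - Δ u = h(t, u)` in `Ω`, the operator being understood as the limit of its
truncations. -/
structure IsEntireSolution (α : ℝ) (n : ℕ) (s Cns : ℝ) (Ω : Set (En n)) (h : ℝ → ℝ → ℝ)
    (u : En n → ℝ → ℝ) : Prop extends SepContBdd u where
  contDiff_time : ∀ x, ContDiff ℝ 1 (u x)
  tendsto_opQuot : ∀ x ∈ Ω, ∀ t,
    Tendsto (fun ε => opQuot α n s Cns ε u x t) (nhdsWithin 0 (Ioi 0)) (nhds (h t (u x t)))

lemma continuous_of_continuousOn_closure {X Y : Type*} [TopologicalSpace X] [TopologicalSpace Y]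
    {Ω : Set X} (hΩ : IsOpen Ω) {c : Y} {f : X → Y} (hf : ContinuousOn f (closure Ω))
    (h0 : ∀ x ∉ Ω, f x = c) : Continuous f := by
  classical
  have h1 : f = (closure Ω).piecewise f fun _ => c := by
    ext x
    by_cases hx : x ∈ closure Ω
    · rw [piecewise_eq_of_mem _ _ _ hx]
    · rw [piecewise_eq_of_notMem _ _ _ hx, h0 x fun h => hx (subset_closure h)]
  rw [h1]
  refine continuous_piecewise (fun x hx => h0 x fun h => ?_)
    (by rwa [isClosed_closure.closure_eq]) continuousOn_const
  exact (frontier_closure_subset hx).2 (hΩ.interior_eq.symm ▸ h)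

lemma isEntireSolution_of_eq {α : ℝ} (hα : 0 < α) (hα1 : α ≤ 1) {n : ℕ} {s Cns : ℝ}
    {Ω : Set (En n)} (hΩ : IsOpen Ω) {h : ℝ → ℝ → ℝ} {u : En n → ℝ → ℝ}
    (hx : ∀ t, ContDiffOn ℝ 2 (fun x => u x t) Ω)
    (hcl : ∀ t, ContinuousOn (fun x => u x t) (closure Ω)) (ht : ∀ x, ContDiff ℝ 1 (u x))
    (hnonneg : ∀ x t, 0 ≤ u x t) {M : ℝ} (hM : ∀ x t, u x t ≤ M) {Lu : En n → ℝ → ℝ}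
    (hLu : ∀ x ∈ Ω, ∀ t, HasFracLap n s Cns (fun y => u y t) x (Lu x t))
    (heq : ∀ x ∈ Ω, ∀ t, marchaud α (u x) t + Lu x t - lap (fun y => u y t) x = h t (u x t))
    (hzero : ∀ x ∉ Ω, ∀ t, u x t = 0) : IsEntireSolution α n s Cns Ω h u where
  cont_space t := continuous_of_continuousOn_closure hΩ (hcl t) fun x hxΩ => hzero x hxΩ t
  cont_time x := (ht x).continuous
  bdd := ⟨M, fun x t => by rw [abs_of_nonneg (hnonneg x t)]; exact hM x t⟩
  contDiff_time := ht
  tendsto_opQuot x hxΩ t := by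
    rw [← heq x hxΩ t]
    refine Tendsto.sub (Tendsto.add (tendsto_timeQuot hα hα1 (ht x) (M := M) (fun r => ?_) t)
      (hLu x hxΩ t)) (tendsto_lapQuot ((hx t).contDiffAt (hΩ.mem_nhds hxΩ)))
    rw [abs_of_nonneg (hnonneg x r)]; exact hM x r

lemma IsEntireSolution.tendsto_opQuot_sub {α : ℝ} (hα : 0 < α) {n : ℕ} (hn : 1 ≤ n) {s : ℝ}
    (hs : s ∈ Ioo (0 : ℝ) 1) {Cns : ℝ} {Ω : Set (En n)} {h : ℝ → ℝ → ℝ} {u : En n → ℝ → ℝ}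
    (hu : IsEntireSolution α n s Cns Ω h u) {ξ ζ x : En n} (hξ : x + ξ ∈ Ω) (hζ : x + ζ ∈ Ω)
    (a b t : ℝ) :
    Tendsto (fun ε => opQuot α n s Cns ε (fun y r => u (y + ξ) (r + a) - u (y + ζ) (r + b)) x t)
      (nhdsWithin 0 (Ioi 0))
      (nhds (h (t + a) (u (x + ξ) (t + a)) - h (t + b) (u (x + ζ) (t + b)))) := by
  refine ((hu.tendsto_opQuot _ hξ (t + a)).sub (hu.tendsto_opQuot _ hζ (t + b))).congr' ?_
  filter_upwards [self_mem_nhdsWithin] with ε hε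
  rw [opQuot_sub hα hn hs Cns hε (hu.shift ξ a) (hu.shift ζ b), opQuot_shift, opQuot_shift]

lemma exists_ball_lipschitz {E : Type*} [MetricSpace E] [LocallyCompactSpace E] {X : Set E}
    (hX : IsLocallyClosed X) (hne : X.Nonempty) {u : E → ℝ → ℝ} (hu : ∀ t, Continuous fun x => u x t)
    (ht : ∀ x, ContDiff ℝ 1 (u x)) (T : ℝ) :
    ∃ x ∈ X, ∃ δ > 0, ∃ N : ℝ, 0 ≤ N ∧ ∀ y ∈ X, dist y x < δ →
      ∀ t ∈ Icc (-T) T, ∀ r ∈ Icc (-T) T, |u y t - u y r| ≤ N * |t - r| := by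
  have := hX.locallyCompactSpace
  have := hne.to_subtype
  set f : ℕ → Set X := fun N => {y : X | ∀ t ∈ Icc (-T) T, ∀ r ∈ Icc (-T) T,
    |u y t - u y r| ≤ N * |t - r|} with hf
  have hclosed : ∀ N, IsClosed (f N) := fun N => by
    simp only [hf, ofPred_forall]
    refine isClosed_iInter fun t => isClosed_iInter fun _ => isClosed_iInter fun r =>
      isClosed_iInter fun _ => isClosed_le ?_ continuous_const
    exact (((hu t).comp continuous_subtype_val).sub ((hu r).comp continuous_subtype_val)).abs
  have hunion : ⋃ N, f N = univ := by
    refine eq_univ_of_forall fun y => ?_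
    obtain ⟨K, hK⟩ := ((ht y).locallyLipschitz.locallyLipschitzOn
      (s := Icc (-T) T)).exists_lipschitzOnWith_of_compact isCompact_Icc
    obtain ⟨N, hN⟩ := exists_nat_ge (K : ℝ)
    refine mem_iUnion.2 ⟨N, fun t htT r hr => ?_⟩
    refine (hK.dist_le_mul t htT r hr).trans ?_
    rw [Real.dist_eq]
    gcongr
  obtain ⟨N, ⟨x, hxX⟩, hx⟩ := nonempty_interior_of_iUnion_of_closed hclosed hunion
  rw [mem_interior_iff_mem_nhds, Metric.mem_nhds_iff] at hx
  obtain ⟨δ, hδ, hsub⟩ := hx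
  exact ⟨x, hxX, δ, hδ, N, N.cast_nonneg, fun y hy hyx =>
    hsub (show (⟨y, hy⟩ : X) ∈ Metric.ball ⟨x, hxX⟩ δ from hyx)⟩

lemma SepContBdd.exists_integral_abs_sub_le {n : ℕ} {u : En n → ℝ → ℝ} (hu : SepContBdd u)
    {K : Set (En n)} (hK : IsCompact K) (T : ℝ) {σ : ℝ} (hσ : 0 < σ) :
    ∃ η > 0, ∀ t ∈ Icc (-T) T, ∀ r ∈ Icc (-T) T, |t - r| < η →
      ∫ y in K, |u y t - u y r| ≤ σ := by
  obtain ⟨M, hM⟩ := hu.bdd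
  have hG : Continuous fun p : ℝ × ℝ => ∫ y in K, |u y p.1 - u y p.2| := by
    refine continuous_of_dominated (bound := fun _ => M + M) (fun p => ?_)
      (fun p => Eventually.of_forall fun y => ?_) (integrableOn_const hK.measure_ne_top)
      (Eventually.of_forall fun y => ?_)
    · exact ((hu.cont_space p.1).sub (hu.cont_space p.2)).abs.aestronglyMeasurable
    · rw [Real.norm_eq_abs, abs_abs]
      exact (abs_sub _ _).trans (add_le_add (hM _ _) (hM _ _))
    · exact (((hu.cont_time y).comp continuous_fst).sub ((hu.cont_time y).comp continuous_snd)).abs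
  have huc := ((isCompact_Icc (a := -T) (b := T)).prod
    (isCompact_Icc (a := -T) (b := T))).uniformContinuousOn_of_continuous hG.continuousOn
  obtain ⟨η, hη, hd⟩ := Metric.uniformContinuousOn_iff.1 huc σ hσ
  refine ⟨η, hη, fun t ht r hr htr => ?_⟩
  have h1 := hd (t, r) ⟨ht, hr⟩ (t, t) ⟨ht, ht⟩ (by
    rw [Prod.dist_eq, dist_self, max_eq_right dist_nonneg, Real.dist_eq, abs_sub_comm]
    exact htr)
  simp only [sub_self, abs_zero, integral_zero, dist_zero_right] at h1
  exact (le_abs_self _).trans h1.le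

lemma le_integral_sub_avg_mul_fracKernel {n : ℕ} (hn : 1 ≤ n) {s : ℝ} (hs : s ∈ Ioo (0 : ℝ) 1)
    {l : ℝ} (hl : 0 < l) {D : Set (En n)} (hD : MeasurableSet D) (hDl : D ⊆ {z | l ≤ ‖z‖})
    (hDv : volume D ≠ ⊤)
    {g : ℕ → En n → ℝ} (hg : ∀ i, Continuous (g i)) {M : ℝ} (hM : ∀ i z, |g i z| ≤ M)
    (hg0 : ∀ i z, 0 ≤ g i z) {m : ℕ} (hm : 0 < m) {κ σ : ℝ}
    (hσ : ∀ i < m, ∫ z in D, g i z ≤ σ) :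
    κ * (∫ z in D, fracKernel n s z) - (l ^ ((n : ℝ) + 2 * s))⁻¹ * σ ≤
      ∫ z in D, (κ - (m : ℝ)⁻¹ * ∑ i ∈ Finset.range m, g i z) * fracKernel n s z := by
  have hk := (integrableOn_fracKernel hn hs hl).mono_set hDl
  have hgi : ∀ i, IntegrableOn (g i) D := fun i =>
    Measure.integrableOn_of_bounded hDv (hg i).aestronglyMeasurable
      (Eventually.of_forall (hM i))
  have hm' : (0 : ℝ) < m := by exact_mod_cast hm
  set S : En n → ℝ := fun z => (m : ℝ)⁻¹ * ∑ i ∈ Finset.range m, g i z with hS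
  have hSc : Continuous S := (continuous_finsetSum _ fun i _ => hg i).const_mul _
  have hS0 : ∀ z, 0 ≤ S z := fun z =>
    mul_nonneg (by positivity) (Finset.sum_nonneg fun i _ => hg0 i z)
  have hSM : ∀ z, |S z| ≤ (m : ℝ)⁻¹ * ∑ _i ∈ Finset.range m, M := fun z => by
    rw [abs_of_nonneg (hS0 z)]
    refine mul_le_mul_of_nonneg_left (Finset.sum_le_sum fun i _ => ?_) (by positivity)
    exact (le_abs_self _).trans (hM i z)
  have hSi : IntegrableOn S D := Measure.integrableOn_of_bounded hDv hSc.aestronglyMeasurable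
      (Eventually.of_forall hSM)
  have hSk : IntegrableOn (fun z => S z * fracKernel n s z) D :=
    (integrableOn_mul_fracKernel hn hs hl hSc.measurable hSM).mono_set hDl
  have hSσ : ∫ z in D, S z ≤ σ := by
    rw [integral_const_mul, integral_finsetSum _ fun i _ => hgi i, inv_mul_le_iff₀ hm']
    refine (Finset.sum_le_card_nsmul _ _ σ fun i hi => hσ i (Finset.mem_range.1 hi)).trans_eq ?_
    simp
  have h1 : ∫ z in D, S z * fracKernel n s z ≤ (l ^ ((n : ℝ) + 2 * s))⁻¹ * σ := by
    refine (setIntegral_mono_on hSk (hSi.const_mul (l ^ ((n : ℝ) + 2 * s))⁻¹) hD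
      fun z hz => ?_).trans ?_
    · rw [mul_comm]
      refine mul_le_mul_of_nonneg_right ?_ (hS0 z)
      have h4 : (0 : ℝ) ≤ (n : ℝ) + 2 * s := by have := hs.1; positivity
      unfold fracKernel
      gcongr
      exact hDl hz
    · rw [integral_const_mul]
      gcongr
  have h2 : ∫ z in D, (κ - S z) * fracKernel n s z =
      κ * (∫ z in D, fracKernel n s z) - ∫ z in D, S z * fracKernel n s z := by
    rw [← integral_const_mul, ← integral_sub (hk.const_mul κ) hSk]
    simp only [sub_mul]
  linarith

/-- Near a ball on which `u` is Lipschitz in time off the set `O` of joint continuity, the time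
increments of `u` are uniformly small. -/
lemma IsEntireSolution.exists_time_increment_le {α : ℝ} (hα : 0 < α) (hα1 : α ≤ 1) {n : ℕ}
    (hn : 1 ≤ n) {s : ℝ} (hs : s ∈ Ioo (0 : ℝ) 1) {Cns : ℝ} (hC : 0 < Cns) {Ω : Set (En n)}
    {h : ℝ → ℝ → ℝ} (hh : Continuous fun p : ℝ × ℝ => h p.1 p.2) {u : En n → ℝ → ℝ}
    (hu : IsEntireSolution α n s Cns Ω h u) {O : Set (En n)} (hO : IsOpen O) (hOΩ : O ⊆ Ω)
    {x' : En n} {δ : ℝ} (hδ : 0 < δ) {S : ℝ}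
    (hcont : ContinuousOn (fun p : En n × ℝ => u p.1 p.2) (O ×ˢ Ioo (-S) S)) {N : ℝ} (hN : 0 ≤ N)
    (hlip : ∀ x ∈ Metric.closedBall x' (2 * δ), x ∉ O → ∀ t ∈ Icc (-S) S, ∀ r ∈ Icc (-S) S,
      |u x t - u x r| ≤ N * |t - r|) {t₁ : ℝ} (ht₁ : t₁ ∈ Ioo (-S) S) {σ : ℝ} (hσ : 0 < σ) :
    ∃ η > 0, ∀ x ∈ Metric.closedBall x' δ, ∀ a b, |a| < η → |b| < η →
      u x (t₁ + a) - u x (t₁ + b) ≤ σ := by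
  obtain ⟨M, hM⟩ := hu.bdd
  have hM0 : 0 ≤ M := (abs_nonneg _).trans (hM 0 0)
  obtain ⟨T, hT, hTS⟩ : ∃ T > 0, ∀ t ∈ Icc (t₁ - 2 * T) (t₁ + T), ∀ a, |a| < T →
      t + a ∈ Ioo (-S) S := by
    have h1 : |t₁| < S := abs_lt.2 ht₁
    refine ⟨(S - |t₁|) / 4, by linarith, fun t ht a ha => ?_⟩
    rw [abs_lt] at ha
    constructor <;> linarith [ht.1, ht.2, ha.1, ha.2, le_abs_self t₁, neg_abs_le t₁]
  obtain ⟨H, hH⟩ := ((isCompact_Icc (a := -S) (b := S)).prod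
    (isCompact_Icc (a := -M) (b := M))).exists_bound_of_continuousOn hh.continuousOn
  have hH' : ∀ t ∈ Ioo (-S) S, ∀ x, |h t (u x t)| ≤ H := fun t ht x =>
    hH (t, u x t) ⟨Ioo_subset_Icc_self ht, abs_le.1 (hM x t)⟩
  have hH0 : 0 ≤ H := (abs_nonneg _).trans (hH' t₁ ht₁ 0)
  let i : Fin n := ⟨0, hn⟩
  obtain ⟨b₀, hb₀, hball⟩ := exists_le_integral_lowerBall hn hs i
  set Q : ℝ := H + H + 2 * M * cutoffCost α n s Cns δ T + 1 with hQ
  obtain ⟨l, hl, hlQ⟩ : ∃ l : ℝ, 0 < l ∧ Q + 1 < Cns * (σ / 4 * (b₀ * (l ^ (2 * s))⁻¹)) := by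
    have h1 : Tendsto (fun l : ℝ => Cns * (σ / 4 * (b₀ * (l ^ (2 * s))⁻¹))) (nhdsWithin 0 (Ioi 0))
        atTop := by
      refine Tendsto.const_mul_atTop hC (Tendsto.const_mul_atTop (by positivity)
        (Tendsto.const_mul_atTop hb₀ (tendsto_inv_nhdsGT_zero.comp ?_)))
      refine tendsto_nhdsWithin_iff.2 ⟨?_, ?_⟩
      · have h2 : ContinuousAt (fun l : ℝ => l ^ (2 * s)) 0 :=
          Real.continuousAt_rpow_const _ _ (Or.inr (by linarith [hs.1]))
        have h3 := h2.tendsto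
        rw [Real.zero_rpow (by linarith [hs.1])] at h3
        exact h3.mono_left nhdsWithin_le_nhds
      · filter_upwards [self_mem_nhdsWithin] with l hl
        exact Real.rpow_pos_of_pos hl _
    obtain ⟨l, hl1, hl2⟩ := ((h1.eventually_gt_atTop (Q + 1)).and self_mem_nhdsWithin).exists
    exact ⟨l, hl2, hl1⟩
  set k₀ : ℝ := ((2 * l) ^ ((n : ℝ) + 2 * s))⁻¹ with hk₀
  have hk₀pos : 0 < k₀ := by positivity
  obtain ⟨η, hη, hsmall⟩ := hu.exists_integral_abs_sub_le
    (isCompact_closedBall x' (2 * δ + 4 * l)) S (σ := (Cns * k₀)⁻¹) (by positivity)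
  refine ⟨min T (min (η / 2) (σ / 2 / (2 * N + 1))), by positivity, fun x₀ hx₀ a b ha hb => ?_⟩
  simp only [lt_min_iff] at ha hb
  by_contra! hlt
  set w : En n → ℝ → ℝ := fun x t => u (x + 0) (t + a) - u (x + 0) (t + b) with hwdef
  have hw : SepContBdd w := (hu.shift 0 a).sub (hu.shift 0 b)
  have hwM : ∀ x t, |w x t| ≤ M + M := fun x t =>
    (abs_sub _ _).trans (add_le_add (hM _ _) (hM _ _))
  have hsub : Metric.closedBall x₀ δ ⊆ Metric.closedBall x' (2 * δ) :=
    Metric.closedBall_subset_closedBall' (by linarith [Metric.mem_closedBall.1 hx₀])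
  have hab : |a - b| < η ∧ N * |a - b| ≤ σ / 2 := by
    have h1 : |a - b| ≤ |a| + |b| := abs_sub _ _
    refine ⟨by linarith [ha.2.1, hb.2.1], ?_⟩
    have h2 := ha.2.2
    have h3 := hb.2.2
    rw [lt_div_iff₀ (by positivity)] at h2 h3
    have := abs_nonneg a
    have := abs_nonneg b
    nlinarith
  have hf : ∀ x, ∀ t ∈ Icc (t₁ - 2 * T) (t₁ + T),
      h (t + a) (u (x + 0) (t + a)) - h (t + b) (u (x + 0) (t + b)) ≤ H + H := fun x t ht => by
    have h1 := abs_le.1 (hH' _ (hTS t ht a ha.1) (x + 0))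
    have h2 := abs_le.1 (hH' _ (hTS t ht b hb.1) (x + 0))
    linarith [h1.2, h2.1]
  obtain ⟨x, hx, m, hm, t, ht, hle⟩ := exists_penalized_bound hα hα1 hn hs hC.le hw
    (c := σ / 2) (κ := σ / 4) (A := 2 * M) (F := H + H) (by positivity) (by positivity)
    (by positivity) hδ hT (x₀ := x₀) (t₀ := t₁)
    (fun x t => by linarith [le_abs_self (w x t), hwM x t])
    (by simp only [hwdef, add_zero]; linarith) hO
    (fun x hx hxO t ht => by
      have h1 := hlip x (hsub hx) hxO (t + a) (Ioo_subset_Icc_self (hTS t ht a ha.1)) (t + b)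
        (Ioo_subset_Icc_self (hTS t ht b hb.1))
      rw [add_sub_add_left_eq_sub] at h1
      simp only [hwdef, add_zero]
      linarith [le_abs_self (u x (t + a) - u x (t + b)), hab.2])
    (by
      simp only [hwdef, add_zero]
      exact (hcont.comp (f := fun p : En n × ℝ => (p.1, p.2 + a)) (by fun_prop)
          fun p hp => ⟨hp.1, hTS p.2 hp.2 a ha.1⟩).sub
        (hcont.comp (f := fun p : En n × ℝ => (p.1, p.2 + b)) (by fun_prop)
          fun p hp => ⟨hp.1, hTS p.2 hp.2 b hb.1⟩))
    (fun x hxO _ t ht _ => ⟨_, hf x t ht, hu.tendsto_opQuot_sub hα hn hs (by simpa using hOΩ hxO)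
      (by simpa using hOΩ hxO) a b t⟩)
    (ε := 1) (l := 2 * l) one_pos (by positivity) (D := lowerBall i l) measurableSet_ball
    (fun z hz => (norm_of_mem_lowerBall hl hz).1)
  have hgc : ∀ i, Continuous fun z => max (w (x + z) (t i) - σ / 2) 0 := fun i =>
    (((hw.cont_space (t i)).comp (by fun_prop : Continuous fun z => x + z)).sub
      continuous_const).max continuous_const
  have h1 := le_integral_sub_avg_mul_fracKernel hn hs (l := 2 * l) (by positivity)
    (D := lowerBall i l) measurableSet_ball (fun z hz => (norm_of_mem_lowerBall hl hz).1)
    measure_ball_lt_top.ne (g := fun i z => max (w (x + z) (t i) - σ / 2) 0)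
    hgc (M := M + M)
    (fun i z => ?_) (fun i z => le_max_right _ _) hm (κ := σ / 4) (σ := (Cns * k₀)⁻¹)
    (fun j hj => ?_)
  · have h2 := hball l hl
    have h3 : Cns * (k₀ * (Cns * k₀)⁻¹) = 1 := by field_simp
    have h4 : Cns * (σ / 4 * (b₀ * (l ^ (2 * s))⁻¹)) ≤
        Cns * (σ / 4 * ∫ z in lowerBall i l, fracKernel n s z) := by gcongr
    have h5 := mul_le_mul_of_nonneg_left h1 hC.le
    rw [mul_sub, h3] at h5
    linarith
  · rw [abs_of_nonneg (le_max_right _ _)]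
    exact max_le (by linarith [le_abs_self (w (x + z) (t i)), hwM (x + z) (t i)]) (by positivity)
  · have h2 := hsmall (t j + a) (Ioo_subset_Icc_self (hTS _ (ht j hj) a ha.1)) (t j + b)
      (Ioo_subset_Icc_self (hTS _ (ht j hj) b hb.1))
      (by rw [add_sub_add_left_eq_sub]; exact hab.1)
    refine le_trans ?_ h2
    have hpi := (measurePreserving_add_left (volume : Measure (En n)) x).setIntegral_preimage_emb
      (Homeomorph.addLeft x).measurableEmbedding (fun y => |u y (t j + a) - u y (t j + b)|)
      (Metric.closedBall x' (2 * δ + 4 * l))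
    rw [← hpi]
    have hc : Continuous fun z => |u (x + z) (t j + a) - u (x + z) (t j + b)| :=
      (((hu.cont_space _).sub (hu.cont_space _)).abs.comp
        (by fun_prop : Continuous fun z => x + z))
    have hball' : lowerBall i l ⊆
        (fun z => x + z) ⁻¹' Metric.closedBall x' (2 * δ + 4 * l) := fun z hz => by
      have h3 := norm_of_mem_lowerBall hl hz
      have h4 := hsub hx
      rw [mem_closedBall_iff_norm] at h4
      rw [mem_preimage, mem_closedBall_iff_norm, add_sub_right_comm]
      exact (norm_add_le _ _).trans (add_le_add h4 h3.2)
    have hpre : (fun z => x + z) ⁻¹' Metric.closedBall x' (2 * δ + 4 * l) =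
        Metric.closedBall (x' - x) (2 * δ + 4 * l) := by
      ext z
      simp only [mem_preimage, mem_closedBall_iff_norm]
      rw [sub_sub_eq_add_sub, add_comm x z]
    have hint : IntegrableOn (fun z => |u (x + z) (t j + a) - u (x + z) (t j + b)|)
        ((fun z => x + z) ⁻¹' Metric.closedBall x' (2 * δ + 4 * l)) := by
      rw [hpre]
      exact hc.continuousOn.integrableOn_compact (isCompact_closedBall _ _)
    have hgle : ∀ z, max (w (x + z) (t j) - σ / 2) 0 ≤
        |u (x + z) (t j + a) - u (x + z) (t j + b)| := fun z => by
      simp only [hwdef, add_zero]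
      exact max_le (by linarith [le_abs_self (u (x + z) (t j + a) - u (x + z) (t j + b))])
        (abs_nonneg _)
    refine (setIntegral_mono_on (Integrable.mono' (hint.mono_set hball')
      (hgc j).aestronglyMeasurable (Eventually.of_forall fun z => ?_)) (hint.mono_set hball')
      measurableSet_ball fun z _ => hgle z).trans (setIntegral_mono_set hint
        (Eventually.of_forall fun z => abs_nonneg _) hball'.eventuallyLE)
    rw [Real.norm_eq_abs, abs_of_nonneg (le_max_right _ _)]
    exact hgle z

/-- Separately regular bounded solutions are jointly continuous. -/
theorem IsEntireSolution.continuousOn {α : ℝ} (hα : 0 < α) (hα1 : α ≤ 1) {n : ℕ}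
    (hn : 1 ≤ n) {s : ℝ} (hs : s ∈ Ioo (0 : ℝ) 1) {Cns : ℝ} (hC : 0 < Cns) {Ω : Set (En n)}
    (hΩ : IsOpen Ω) {h : ℝ → ℝ → ℝ} (hh : Continuous fun p : ℝ × ℝ => h p.1 p.2)
    {u : En n → ℝ → ℝ} (hu : IsEntireSolution α n s Cns Ω h u) :
    ContinuousOn (fun p : En n × ℝ => u p.1 p.2) (Ω ×ˢ univ) := by
  have key : ∀ S : ℝ, ∀ x ∈ Ω, ∀ t ∈ Ioo (-S) S,
      ContinuousAt (fun p : En n × ℝ => u p.1 p.2) (x, t) := by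
    intro S
    set C : Set (En n) := {x | ∀ t ∈ Ioo (-S) S,
      ContinuousAt (fun p : En n × ℝ => u p.1 p.2) (x, t)} with hCdef
    set O : Set (En n) := Ω ∩ interior C with hOdef
    have hO : IsOpen O := hΩ.inter isOpen_interior
    suffices hX : Ω \ O = ∅ by
      intro x hx
      exact interior_subset (s := C) (sdiff_eq_empty.1 hX hx).2
    rw [← not_nonempty_iff_eq_empty]
    intro hne
    obtain ⟨x', ⟨hx'Ω, hx'O⟩, δ, hδ, N, hN, hlip⟩ := exists_ball_lipschitz
      (hΩ.isLocallyClosed.inter hO.isClosed_compl.isLocallyClosed) hne hu.cont_space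
      hu.contDiff_time S
    obtain ⟨δ', hδ', hδΩ⟩ := Metric.isOpen_iff.1 hΩ x' hx'Ω
    obtain ⟨d, hd, hdδ, hdδ'⟩ : ∃ d, 0 < d ∧ 2 * d < δ ∧ 2 * d < δ' :=
      ⟨min δ δ' / 4, by positivity, by linarith [min_le_left δ δ'],
        by linarith [min_le_right δ δ']⟩
    refine hx'O ⟨hx'Ω, mem_interior_iff_mem_nhds.2
      (mem_of_superset (Metric.ball_mem_nhds x' hd) fun x₁ hx₁ t₁ ht₁ => ?_)⟩
    rw [Metric.continuousAt_iff]
    intro σ hσ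
    obtain ⟨η, hη, hinc⟩ := hu.exists_time_increment_le hα hα1 hn hs hC hh hO inter_subset_left hd
      (S := S) (fun p hp => ((interior_subset hp.1.2 : p.1 ∈ C) p.2 hp.2).continuousWithinAt) hN
      (fun x hx hxO => hlip x ⟨hδΩ (Metric.closedBall_subset_ball hdδ' hx), hxO⟩
        (Metric.closedBall_subset_ball hdδ hx)) ht₁ (half_pos hσ)
    obtain ⟨γ, hγ, hsp⟩ := Metric.continuousAt_iff.1 ((hu.cont_space t₁).continuousAt (x := x₁))
      (σ / 2) (half_pos hσ)
    obtain ⟨γ', hγ', hball⟩ := Metric.isOpen_iff.1 Metric.isOpen_ball x₁ hx₁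
    refine ⟨min η (min γ γ'), by positivity, fun p hp => ?_⟩
    simp only [lt_min_iff, Prod.dist_eq, max_lt_iff] at hp
    have h1 := hsp hp.2.1.1
    have h2 := Metric.ball_subset_closedBall (hball (Metric.mem_ball.2 hp.2.2.1))
    have h3 : |p.2 - t₁| < η := hp.1.2
    have h4 := hinc p.1 h2 (p.2 - t₁) 0 h3 (by simpa using hη)
    have h5 := hinc p.1 h2 0 (p.2 - t₁) (by simpa using hη) h3
    rw [add_zero, add_sub_cancel] at h4 h5
    rw [Real.dist_eq] at h1 ⊢
    rw [abs_lt] at h1 ⊢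
    constructor <;> linarith [h1.1, h1.2]
  rintro ⟨x, t⟩ ⟨hx, -⟩
  exact (key (|t| + 1) x hx t (abs_lt.1 (lt_add_one _))).continuousWithinAt

lemma cutoffCost_rpow_le {α : ℝ} (hα : 0 < α) (n : ℕ) {s : ℝ} (hs : s ∈ Ioo (0 : ℝ) 1) (Cns : ℝ)
    {R : ℝ} (hR : 1 ≤ R) :
    cutoffCost α n s Cns R (R ^ (2 * s / α)) ≤
      (timeConst α + Cns * fracMass n s + 2 * n) * (R ^ (2 * s))⁻¹ := by
  have h1 : (R ^ (2 * s / α)) ^ α = R ^ (2 * s) := by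
    rw [← Real.rpow_mul (by linarith), div_mul_cancel₀ _ hα.ne']
  have h2 : (R ^ 2)⁻¹ ≤ (R ^ (2 * s))⁻¹ := by
    rw [← Real.rpow_two]
    gcongr
    linarith [hs.2]
  have h3 : (n : ℝ) * (R ^ 2)⁻¹ ≤ n * (R ^ (2 * s))⁻¹ := by gcongr
  unfold cutoffCost
  rw [h1, div_eq_mul_inv]
  linarith

lemma add_smul_eDir_apply {n : ℕ} (i : Fin n) (x : En n) (τ : ℝ) :
    (x + τ • eDir i) i = x i + τ := by
  simp [eDir]

/-- A bounded nonnegative solution in a half-space vanishing outside it lies below its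
translates. -/
lemma IsEntireSolution.le_translate {α : ℝ} (hα : 0 < α) (hα1 : α ≤ 1) {n : ℕ}
    (hn : 1 ≤ n) {s : ℝ} (hs : s ∈ Ioo (0 : ℝ) 1) {Cns : ℝ} (hC : 0 < Cns) {i : Fin n}
    {h : ℝ → ℝ → ℝ} (hh : Continuous fun p : ℝ × ℝ => h p.1 p.2) (hanti : ∀ t, Antitone (h t))
    {u : En n → ℝ → ℝ} (hu : IsEntireSolution α n s Cns {x | 0 < x i} h u)
    (hnonneg : ∀ x t, 0 ≤ u x t) (hzero : ∀ x ∉ {x : En n | 0 < x i}, ∀ t, u x t = 0)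
    {τ : ℝ} (hτ : 0 < τ) (x : En n) (t : ℝ) : u x t ≤ u (x + τ • eDir i) t := by
  have hΩ : IsOpen {x : En n | 0 < x i} :=
    isOpen_lt continuous_const (PiLp.continuous_apply 2 (fun _ => ℝ) i)
  have hΩτ : ∀ x : En n, 0 < x i → 0 < (x + τ • eDir i) i := fun x hx => by
    rw [add_smul_eDir_apply]; linarith
  have hcont := hu.continuousOn hα hα1 hn hs hC hΩ hh
  set v : En n → ℝ → ℝ := fun x t => u (x + 0) (t + 0) - u (x + τ • eDir i) (t + 0) with hvdef
  have hv : SepContBdd v := (hu.shift 0 0).sub (hu.shift (τ • eDir i) 0)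
  have hv0 : ∀ x : En n, ¬ 0 < x i → ∀ t, v x t ≤ 0 := fun x hx t => by
    simp only [hvdef, add_zero]
    rw [hzero x hx t]
    linarith [hnonneg (x + τ • eDir i) t]
  by_contra! hlt
  obtain ⟨M, hM⟩ := hv.bdd
  have hbdd : BddAbove (range fun p : En n × ℝ => v p.1 p.2) :=
    ⟨M, by rintro _ ⟨p, rfl⟩; exact (le_abs_self _).trans (hM _ _)⟩
  set S := ⨆ p : En n × ℝ, v p.1 p.2 with hSdef
  have hvS : ∀ x t, v x t ≤ S := fun x t => le_ciSup hbdd (x, t)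
  have hS : 0 < S := by
    refine lt_of_lt_of_le ?_ (hvS x t)
    simp only [hvdef, add_zero]; linarith
  obtain ⟨b, hb, hball⟩ := exists_le_integral_lowerBall hn hs i
  set K := timeConst α + Cns * fracMass n s + 2 * n with hK
  have hK0 : 0 ≤ K := by
    have h1 := timeConst_nonneg hα hα1
    have h2 := fracMass_nonneg n s
    positivity
  obtain ⟨ε, hε, hεS, hεK⟩ : ∃ ε > 0, ε ≤ S / 4 ∧ ε * (2 * K + 1) < Cns * (S / 2 * b) := by
    refine ⟨min (S / 4) (Cns * (S / 2 * b) / (2 * K + 2)), by positivity, min_le_left _ _, ?_⟩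
    have h1 := min_le_right (S / 4) (Cns * (S / 2 * b) / (2 * K + 2))
    rw [le_div_iff₀ (by positivity)] at h1
    have h2 : 0 < min (S / 4) (Cns * (S / 2 * b) / (2 * K + 2)) := by positivity
    linarith
  obtain ⟨⟨x₀, t₀⟩, h₀⟩ := exists_lt_of_lt_ciSup (show S - ε < S by linarith)
  simp only at h₀
  set R := max 1 (x₀ i) with hR
  have hR1 : 1 ≤ R := le_max_left _ _
  have hR0 : 0 < R := by linarith
  have hRs : 0 < R ^ (2 * s) := by positivity
  obtain ⟨x₁, hx₁, m, hm, r, hr, hle⟩ := exists_penalized_bound hα hα1 hn hs hC.le hv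
    (c := 0) (κ := S - 2 * ε) (A := 2 * ε) (F := 0) (by positivity) (by linarith) le_rfl hR0
    (T := R ^ (2 * s / α)) (by positivity) (x₀ := x₀) (t₀ := t₀)
    (fun x t => by linarith [hvS x t]) (by linarith) hΩ
    (fun x _ hx t _ => hv0 x hx t)
    (by
      simp only [hvdef, add_zero]
      exact (hcont.mono (prod_mono subset_rfl (subset_univ _))).sub
        (hcont.comp (f := fun p : En n × ℝ => (p.1 + τ • eDir i, p.2)) (by fun_prop)
          fun p hp => ⟨hΩτ p.1 hp.1, mem_univ _⟩))
    (fun x hx _ t _ hpos => ⟨_, sub_nonpos.2 (hanti (t + 0) (sub_pos.1 hpos).le),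
      hu.tendsto_opQuot_sub hα hn hs (by simpa using hx) (hΩτ x hx) 0 0 t⟩)
    (ε := ε * (R ^ (2 * s))⁻¹) (l := 2 * R) (by positivity) (by positivity)
    (D := lowerBall i R) measurableSet_ball (fun z hz => (norm_of_mem_lowerBall hR0 hz).1)
  have h1 : ∫ z in lowerBall i R, (S - 2 * ε - (m : ℝ)⁻¹ *
      ∑ j ∈ Finset.range m, max (v (x₁ + z) (r j) - 0) 0) * fracKernel n s z =
      (S - 2 * ε) * ∫ z in lowerBall i R, fracKernel n s z := by
    rw [← integral_const_mul]
    refine setIntegral_congr_fun measurableSet_ball fun z hz => ?_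
    have h2 : ¬ 0 < (x₁ + z) i := by
      have h3 := apply_le_of_mem_lowerBall hz
      have h4 := (PiLp.norm_apply_le (x₁ - x₀) i).trans (mem_closedBall_iff_norm.1 hx₁)
      rw [Real.norm_eq_abs, PiLp.sub_apply] at h4
      rw [PiLp.add_apply]
      linarith [le_abs_self (x₁ i - x₀ i), le_max_right 1 (x₀ i)]
    have h5 : ∑ j ∈ Finset.range m, max (v (x₁ + z) (r j) - 0) 0 = 0 :=
      Finset.sum_eq_zero fun j _ => max_eq_right (by linarith [hv0 (x₁ + z) h2 (r j)])
    rw [h5, mul_zero, sub_zero]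
  rw [h1] at hle
  have h2 : Cns * (S / 2 * (b * (R ^ (2 * s))⁻¹)) ≤
      Cns * ((S - 2 * ε) * ∫ z in lowerBall i R, fracKernel n s z) := by
    gcongr
    · linarith
    · linarith
    · exact hball R hR0
  have h3 : 2 * ε * cutoffCost α n s Cns R (R ^ (2 * s / α)) ≤
      2 * ε * (K * (R ^ (2 * s))⁻¹) := by
    gcongr
    exact cutoffCost_rpow_le hα n hs Cns hR1
  have h4 : ε * (2 * K + 1) * (R ^ (2 * s))⁻¹ < Cns * (S / 2 * b) * (R ^ (2 * s))⁻¹ := by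
    gcongr
  linarith

/-- If `v ≤ 0` attains the value `0`, then its nonlocal tail is controlled by the operator. -/
lemma SepContBdd.integral_tail_le {α : ℝ} (hα : 0 < α) (hα1 : α ≤ 1) {n : ℕ} (hn : 1 ≤ n) {s : ℝ}
    (hs : s ∈ Ioo (0 : ℝ) 1) {Cns : ℝ} (hC : 0 ≤ Cns) {v : En n → ℝ → ℝ} (hv : SepContBdd v)
    (hle : ∀ x t, v x t ≤ 0) {x : En n} {t : ℝ} (h0 : v x t = 0) {f : ℝ}
    (hf : Tendsto (fun ε => opQuot α n s Cns ε v x t) (nhdsWithin 0 (Ioi 0)) (nhds f))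
    {r : ℝ} (hr : 0 < r) :
    Cns * (∫ z in {z : En n | r ≤ ‖z‖}, -v (x + z) t * fracKernel n s z) ≤ f := by
  obtain ⟨M, hM⟩ := hv.bdd
  refine ge_of_tendsto hf ?_
  filter_upwards [Ioo_mem_nhdsGT hr] with ε hε
  have := opQuot_ge hα hα1 hn hs hC hε.1 hε.2.le hv (x := x) (t := t) (P := fun _ => 0)
    (B := fun z => -v (x + z) t) measurable_const (MP := 0) (by simp)
    (((hv.cont_space t).comp (by fun_prop : Continuous fun z => x + z)).neg.measurable) (MB := M)
    (fun z => by rw [abs_neg]; exact hM _ _) (fun z _ => neg_nonneg.2 (hle _ _))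
    (A := 0) (R := 1) (T := 1) (η := 0) le_rfl one_pos one_pos le_rfl (by simp)
    (fun z => by rw [h0]; simp) (fun ρ _ => by rw [h0]; simpa using hle x (t - ρ))
  simpa using this

/-- monotonicity in the upper half-space for the mixed operator (parabolic). -/
theorem monotonicity_half_space_parabolic
    (n : ℕ) (hn : 1 ≤ n) (i₀ : Fin n) (hi₀ : (i₀ : ℕ) = n - 1)
    (s : ℝ) (hs : s ∈ Set.Ioo (0 : ℝ) 1)
    (α : ℝ) (hα : 0 < α) (hα1 : α ≤ 1) (Cns : ℝ) (hCns : 0 < Cns)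
    (h : ℝ → ℝ → ℝ) (hhc : Continuous fun p : ℝ × ℝ => h p.1 p.2)
    (hha : ∀ t : ℝ, Antitone (h t))
    (u : En n → ℝ → ℝ)
    (huX : ∀ t : ℝ, ContDiffOn ℝ 2 (fun x => u x t) {x : En n | 0 < x i₀} ∧
      (MemL2s n s fun x => u x t) ∧
      ContinuousOn (fun x => u x t) (closure {x : En n | 0 < x i₀}))
    (huT : ∀ x : En n, ContDiff ℝ 1 (u x) ∧ MemLminus α (u x))
    (hnonneg : ∀ x t, 0 ≤ u x t) (hbdd : ∃ M : ℝ, ∀ x t, u x t ≤ M)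
    (Lu : En n → ℝ → ℝ)
    (hLu : ∀ x ∈ {x : En n | 0 < x i₀}, ∀ t : ℝ,
      HasFracLap n s Cns (fun y => u y t) x (Lu x t))
    (heq : ∀ x ∈ {x : En n | 0 < x i₀}, ∀ t : ℝ,
      marchaud α (u x) t + Lu x t - lap (fun y => u y t) x = h t (u x t))
    (hpos : ∀ x ∈ {x : En n | 0 < x i₀}, ∀ t : ℝ, 0 < u x t)
    (hzero : ∀ x ∉ {x : En n | 0 < x i₀}, ∀ t : ℝ, u x t = 0) :
    ∀ τ : ℝ, 0 < τ → ∀ t : ℝ, ∀ x ∈ {x : En n | 0 < x i₀},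
      u x t < u (x + τ • eDir i₀) t := by
  obtain ⟨M, hM⟩ := hbdd
  have hΩ : IsOpen {x : En n | 0 < x i₀} :=
    isOpen_lt continuous_const (PiLp.continuous_apply 2 (fun _ => ℝ) i₀)
  have hu := isEntireSolution_of_eq hα hα1 hΩ (fun t => (huX t).1) (fun t => (huX t).2.2)
    (fun x => (huT x).1) hnonneg hM hLu heq hzero
  intro τ hτ t x hx
  have hle := fun y r => hu.le_translate hα hα1 hn hs hCns hhc hha hnonneg hzero hτ y r
  refine lt_of_le_of_ne (hle x t) fun heq' => ?_
  have hxτ : x + τ • eDir i₀ ∈ {x : En n | 0 < x i₀} := by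
    have : 0 < x i₀ := hx
    rw [mem_ofPred_eq, add_smul_eDir_apply]; linarith
  have hlim := hu.tendsto_opQuot_sub hα hn hs (ξ := 0) (ζ := τ • eDir i₀) (by simpa using hx) hxτ
    0 0 t
  have hv := (hu.shift 0 0).sub (hu.shift (τ • eDir i₀) 0)
  have hx0 : 0 < x i₀ := hx
  have htail := hv.integral_tail_le hα hα1 hn hs hCns.le
    (fun y r => by simpa using hle y r) (by simpa using sub_eq_zero.2 heq') hlim hx0
  simp only [add_zero, ← heq', sub_self, neg_sub] at htail
  refine htail.not_gt (mul_pos hCns ?_)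
  have hc : Continuous fun z => u (x + z + τ • eDir i₀) t - u (x + z) t :=
    ((hu.cont_space t).comp (by fun_prop : Continuous fun z => x + z + τ • eDir i₀)).sub
      ((hu.cont_space t).comp (by fun_prop : Continuous fun z => x + z))
  have hbd : ∀ z, |u (x + z + τ • eDir i₀) t - u (x + z) t| ≤ M := fun z =>
    abs_sub_le_of_nonneg_of_le (hnonneg _ _) (hM _ _) (hnonneg _ _) (hM _ _)
  rw [setIntegral_pos_iff_support_of_nonneg_ae
    (Eventually.of_forall fun z => mul_nonneg (sub_nonneg.2 (hle _ _)) (fracKernel_nonneg n s z))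
    (integrableOn_mul_fracKernel hn hs hx0 hc.measurable hbd)]
  have hU : IsOpen {z : En n | x i₀ < ‖z‖ ∧ 0 < u (x + z + τ • eDir i₀) t - u (x + z) t} :=
    (isOpen_lt continuous_const continuous_norm).inter (isOpen_lt continuous_const hc)
  refine (hU.measure_pos volume ⟨(-(x i₀ + τ / 2)) • eDir i₀, ?_, ?_⟩).trans_le
    (measure_mono fun z hz => ⟨(mul_pos hz.2 ?_).ne', hz.1.le⟩)
  · have : ‖(-(x i₀ + τ / 2)) • (eDir i₀ : En n)‖ = x i₀ + τ / 2 := by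
      rw [norm_smul, Real.norm_eq_abs, abs_neg, abs_of_pos (by positivity)]
      simp [eDir]
    rw [this]; linarith
  · rw [hzero (x + (-(x i₀ + τ / 2)) • eDir i₀) (by
      rw [mem_ofPred_eq, add_smul_eDir_apply]; linarith), sub_zero]
    refine hpos _ ?_ t
    rw [mem_ofPred_eq, add_smul_eDir_apply, add_smul_eDir_apply]; linarith
  · have : 0 < ‖z‖ := hx0.trans hz.1
    unfold fracKernel; positivity
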